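/- arXiv:2501.04501 — 2 statements merged into one kernel-verified Lean document; each statement's English description precedes it below -/
import Mathlib

section
/- Under conditions (★), the orbit Õ₂ decomposes as Õ₂ = { Σ_{k=0}^{2} (1/k!) ad*(v)^k χ̃₂ : v ∈ g_{1,0} ⊕ g_{1,1} } ⊕ ad*(g_{1,2}) χ̃₂; equivalently, for v ∈ g_{1,0} ⊕ g_{1,1} and w ∈ g_{1,2}, one has ad*(v+w)² χ̃₂ = ad*(v)² χ̃₂. -/
open Finset in
/-- A Cauchy product whose factors are supported below `m` can be summed over any long enough
range of antidiagonals. -/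
theorem sum_range_sum_antidiagonal_of_support {M : Type*} [AddCommMonoid M] (f : ℕ → ℕ → M)
    (m n : ℕ) (hmn : 2 * m ≤ n) (hf : ∀ i j, m ≤ i ∨ m ≤ j → f i j = 0) :
    ∑ k ∈ range n, ∑ p ∈ antidiagonal k, f p.1 p.2 = ∑ i ∈ range m, ∑ j ∈ range m, f i j := by
  rw [← sum_product', ← sum_fiberwise_of_maps_to (s := range m ×ˢ range m) (t := range n)
    (g := fun p : ℕ × ℕ => p.1 + p.2)]
  · refine sum_congr rfl fun k _ => (sum_subset ?_ ?_).symm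
    · intro p hp
      simp only [mem_filter, HasAntidiagonal.mem_antidiagonal] at hp ⊢
      exact hp.2
    · intro p hp hp'
      simp only [mem_filter, HasAntidiagonal.mem_antidiagonal, mem_product, mem_range] at hp hp'
      exact hf _ _ (by omega)
  · intro p hp
    simp only [mem_product, mem_range] at hp ⊢
    omega

/-- A triangular decomposition `S₀ + S₁ + S₂` of a subalgebra `N` in which `S₁ + S₂` is an ideal,
`⁅S₁, N⁆` has no component in `S₀`, and the functional `χ` is stabilized by `S₀ + S₂`. -/
structure IsStabilizedTriangular {L : Type*} [LieRing L] [LieAlgebra ℂ L] (χ : L →ₗ[ℂ] ℂ)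
    (N S₀ S₁ S₂ : Submodule ℂ L) : Prop where
  sup_eq : S₀ ⊔ S₁ ⊔ S₂ = N
  lie₀₀ : ∀ x ∈ S₀, ∀ y ∈ S₀, ⁅x, y⁆ ∈ S₀
  lie₁₀ : ∀ x ∈ S₁, ∀ y ∈ S₀, ⁅x, y⁆ ∈ S₁
  lie₂₀ : ∀ x ∈ S₂, ∀ y ∈ S₀, ⁅x, y⁆ ∈ S₂
  lie₁₁ : ∀ x ∈ S₁, ∀ y ∈ S₁, ⁅x, y⁆ ∈ S₂
  lie₁₂ : ∀ x ∈ S₁, ∀ y ∈ S₂, ⁅x, y⁆ ∈ S₂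
  lie₂₂ : ∀ x ∈ S₂, ∀ y ∈ S₂, ⁅x, y⁆ ∈ S₂
  stab₀ : ∀ x ∈ S₀, ∀ y ∈ N, χ ⁅x, y⁆ = 0
  stab₂ : ∀ x ∈ S₂, ∀ y ∈ N, χ ⁅x, y⁆ = 0

namespace IsStabilizedTriangular

/-- The derivatives at `0` of the `S₁`-valued curve whose exponential moves `χ` in the same way as
the exponential of `n + u`. -/
def curve {L : Type*} [LieRing L] (n u : L) : ℕ → L
  | 0 => 0
  | k + 1 => (fun y => ⁅y, n⁆)^[k] u

theorem curve_succ {L : Type*} [LieRing L] (n u : L) (k : ℕ) :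
    curve n u (k + 1) = ⁅curve n u k, n⁆ + if k = 0 then u else 0 := by
  cases k with
  | zero => simp [curve]
  | succ k => simp [curve, Function.iterate_succ_apply']

variable {L : Type*} [LieRing L] [LieAlgebra ℂ L] {χ : L →ₗ[ℂ] ℂ} {N S₀ S₁ S₂ : Submodule ℂ L}

theorem le₀ (h : IsStabilizedTriangular χ N S₀ S₁ S₂) : S₀ ≤ N :=
  h.sup_eq ▸ le_sup_left.trans le_sup_left

theorem le₁ (h : IsStabilizedTriangular χ N S₀ S₁ S₂) : S₁ ≤ N :=
  h.sup_eq ▸ le_sup_right.trans le_sup_left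

theorem le₂ (h : IsStabilizedTriangular χ N S₀ S₁ S₂) : S₂ ≤ N :=
  h.sup_eq ▸ le_sup_right

theorem exists_add (h : IsStabilizedTriangular χ N S₀ S₁ S₂) {x : L} (hx : x ∈ N) :
    ∃ a ∈ S₀, ∃ b ∈ S₁, ∃ c ∈ S₂, x = a + b + c := by
  rw [← h.sup_eq, Submodule.mem_sup] at hx
  obtain ⟨y, hy, c, hc, rfl⟩ := hx
  obtain ⟨a, ha, b, hb, rfl⟩ := Submodule.mem_sup.1 hy
  exact ⟨a, ha, b, hb, c, hc, rfl⟩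

theorem lie_mem (h : IsStabilizedTriangular χ N S₀ S₁ S₂) {x y : L} (hx : x ∈ N) (hy : y ∈ N) :
    ⁅x, y⁆ ∈ N := by
  obtain ⟨a, ha, b, hb, c, hc, rfl⟩ := h.exists_add hx
  obtain ⟨a', ha', b', hb', c', hc', rfl⟩ := h.exists_add hy
  simp only [add_lie, lie_add]
  refine N.add_mem (N.add_mem (N.add_mem (N.add_mem ?_ ?_) ?_) (N.add_mem (N.add_mem ?_ ?_) ?_))
    (N.add_mem (N.add_mem ?_ ?_) ?_)
  · exact h.le₀ (h.lie₀₀ _ ha _ ha')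
  · exact h.le₁ (h.lie₁₀ _ hb _ ha')
  · exact h.le₂ (h.lie₂₀ _ hc _ ha')
  · exact lie_skew a b' ▸ N.neg_mem (h.le₁ (h.lie₁₀ _ hb' _ ha))
  · exact h.le₂ (h.lie₁₁ _ hb _ hb')
  · exact lie_skew c b' ▸ N.neg_mem (h.le₂ (h.lie₁₂ _ hb' _ hc))
  · exact lie_skew a c' ▸ N.neg_mem (h.le₂ (h.lie₂₀ _ hc' _ ha))
  · exact h.le₂ (h.lie₁₂ _ hb _ hc')
  · exact h.le₂ (h.lie₂₂ _ hc _ hc')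

theorem ad_pow_mem (h : IsStabilizedTriangular χ N S₀ S₁ S₂) {v x : L} (hv : v ∈ N) (hx : x ∈ N)
    (k : ℕ) : ((LieAlgebra.ad ℂ L v) ^ k) x ∈ N := by
  induction k with
  | zero => simpa using hx
  | succ k ih => rw [pow_succ', Module.End.mul_apply]; exact h.lie_mem hv ih

theorem lie_comm₁ (h : IsStabilizedTriangular χ N S₀ S₁ S₂) {u v x : L} (hu : u ∈ S₁)
    (hv : v ∈ S₁) (hx : x ∈ N) : χ ⁅u, ⁅v, x⁆⁆ = χ ⁅v, ⁅u, x⁆⁆ := by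
  rw [leibniz_lie, map_add, h.stab₂ _ (h.lie₁₁ _ hu _ hv) _ hx, zero_add]

theorem lie₁_lie₀ (h : IsStabilizedTriangular χ N S₀ S₁ S₂) {u n x : L} (hu : u ∈ S₁)
    (hn : n ∈ S₀) (hx : x ∈ N) : χ ⁅u, ⁅n, x⁆⁆ = χ ⁅⁅u, n⁆, x⁆ := by
  rw [leibniz_lie, map_add, h.stab₀ _ hn _ (h.lie_mem (h.le₁ hu) hx), add_zero]

theorem lie₁_lie₂ (h : IsStabilizedTriangular χ N S₀ S₁ S₂) {u z x : L} (hu : u ∈ S₁)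
    (hz : z ∈ S₂) (hx : x ∈ N) : χ ⁅u, ⁅z, x⁆⁆ = 0 := by
  rw [leibniz_lie, map_add, h.stab₂ _ (h.lie₁₂ _ hu _ hz) _ hx,
    h.stab₂ _ hz _ (h.lie_mem (h.le₁ hu) hx), add_zero]

theorem lie₁_lie₁_lie₂ (h : IsStabilizedTriangular χ N S₀ S₁ S₂) {u v z x : L} (hu : u ∈ S₁)
    (hv : v ∈ S₁) (hz : z ∈ S₂) (hx : x ∈ N) : χ ⁅u, ⁅v, ⁅z, x⁆⁆⁆ = 0 := by
  rw [leibniz_lie v z x, lie_add, map_add, h.lie₁_lie₂ hu (h.lie₁₂ _ hv _ hz) hx,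
    h.lie₁_lie₂ hu hz (h.lie_mem (h.le₁ hv) hx), add_zero]

theorem lie₁_lie₁_lie₁ (h : IsStabilizedTriangular χ N S₀ S₁ S₂) {u v w x : L} (hu : u ∈ S₁)
    (hv : v ∈ S₁) (hw : w ∈ S₁) (hx : x ∈ N) : χ ⁅u, ⁅v, ⁅w, x⁆⁆⁆ = 0 := by
  have key : ⁅v, ⁅w, x⁆⁆ ∈ S₂ := by
    obtain ⟨a, ha, b, hb, c, hc, rfl⟩ := h.exists_add hx
    simp only [lie_add]
    exact S₂.add_mem (S₂.add_mem (h.lie₁₁ _ hv _ (h.lie₁₀ _ hw _ ha))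
      (h.lie₁₂ _ hv _ (h.lie₁₁ _ hw _ hb))) (h.lie₁₂ _ hv _ (h.lie₁₂ _ hw _ hc))
  rw [← lie_skew, map_neg, h.stab₂ _ key _ (h.le₁ hu), neg_zero]

theorem curve_mem (h : IsStabilizedTriangular χ N S₀ S₁ S₂) {n u : L} (hn : n ∈ S₀)
    (hu : u ∈ S₁) (k : ℕ) : curve n u k ∈ S₁ := by
  induction k with
  | zero => exact S₁.zero_mem
  | succ k ih =>
    rw [curve_succ]
    refine S₁.add_mem (h.lie₁₀ _ ih _ hn) ?_
    split_ifs
    exacts [hu, S₁.zero_mem]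

theorem curve_eq_zero {n u : L} {K : ℕ} (hn : (LieAlgebra.ad ℂ L n) ^ (K + 1) = 0) {k : ℕ}
    (hk : K + 2 ≤ k) : curve n u k = 0 := by
  have key : ∀ j, (fun y => ⁅y, n⁆)^[j] u = (-1 : ℂ) ^ j • ((LieAlgebra.ad ℂ L n) ^ j) u := by
    intro j
    induction j with
    | zero => simp
    | succ j ih =>
      rw [Function.iterate_succ_apply', ih, pow_succ' (LieAlgebra.ad ℂ L n), Module.End.mul_apply,
        LieAlgebra.ad_apply, smul_lie, ← lie_skew, pow_succ, smul_neg, mul_neg_one, neg_smul]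
  obtain ⟨j, rfl⟩ : ∃ j, k = K + 1 + j + 1 := ⟨k - (K + 2), by omega⟩
  rw [curve, key, pow_add (LieAlgebra.ad ℂ L n), hn, zero_mul, LinearMap.zero_apply, smul_zero]

open Finset in
theorem apply_ad_pow (h : IsStabilizedTriangular χ N S₀ S₁ S₂) {n u z : L} (hn : n ∈ S₀)
    (hu : u ∈ S₁) (hz : z ∈ S₂) (k : ℕ) {x : L} (hx : x ∈ N) :
    χ (((LieAlgebra.ad ℂ L (n + u + z)) ^ (k + 1)) x) =
      χ ⁅curve n u (k + 1), x⁆ + (1 / 2 : ℂ) * ∑ p ∈ antidiagonal (k + 1),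
        ((k + 1).choose p.1 : ℂ) * χ ⁅curve n u p.1, ⁅curve n u p.2, x⁆⁆ := by
  have hq := h.curve_mem hn hu
  induction k generalizing x with
  | zero =>
    simp [Nat.antidiagonal_succ, curve, h.stab₀ _ hn _ hx, h.stab₂ _ hz _ hx]
  | succ k ih =>
    have hv : n + u + z ∈ N := N.add_mem (N.add_mem (h.le₀ hn) (h.le₁ hu)) (h.le₂ hz)
    rw [pow_succ, Module.End.mul_apply, LieAlgebra.ad_apply, ih (h.lie_mem hv hx)]
    have h1 : χ ⁅curve n u (k + 1), ⁅n + u + z, x⁆⁆ =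
        χ ⁅curve n u (k + 1 + 1), x⁆ + χ ⁅curve n u (k + 1), ⁅u, x⁆⁆ := by
      rw [curve_succ n u (k + 1), if_neg k.succ_ne_zero, add_zero]
      simp only [add_lie, lie_add, map_add, h.lie₁_lie₀ (hq _) hn hx, h.lie₁_lie₂ (hq _) hz hx,
        add_zero]
    have h2 : ∀ i j, χ ⁅curve n u i, ⁅curve n u j, ⁅n + u + z, x⁆⁆⁆ =
        χ ⁅curve n u i, ⁅⁅curve n u j, n⁆, x⁆⁆ + χ ⁅⁅curve n u i, n⁆, ⁅curve n u j, x⁆⁆ := by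
      intro i j
      rw [← h.lie₁_lie₀ (hq i) hn (h.lie_mem (h.le₁ (hq j)) hx), ← map_add, ← lie_add,
        ← leibniz_lie]
      simp only [add_lie, lie_add, map_add, h.lie₁_lie₁_lie₁ (hq i) (hq j) hu hx,
        h.lie₁_lie₁_lie₂ (hq i) (hq j) hz hx, add_zero]
    have h3 : ∀ i j, χ ⁅curve n u i, ⁅curve n u (j + 1), x⁆⁆ =
        χ ⁅curve n u i, ⁅⁅curve n u j, n⁆, x⁆⁆ +
          if j = 0 then χ ⁅curve n u i, ⁅u, x⁆⁆ else 0 := by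
      intro i j
      rw [curve_succ]
      split_ifs <;> simp
    have h4 : ∀ i j, χ ⁅curve n u (i + 1), ⁅curve n u j, x⁆⁆ =
        χ ⁅⁅curve n u i, n⁆, ⁅curve n u j, x⁆⁆ +
          if i = 0 then χ ⁅u, ⁅curve n u j, x⁆⁆ else 0 := by
      intro i j
      rw [curve_succ]
      split_ifs <;> simp
    have h5 : ∑ p ∈ antidiagonal (k + 1), ((k + 1).choose p.1 : ℂ) *
        (if p.2 = 0 then χ ⁅curve n u p.1, ⁅u, x⁆⁆ else 0) = χ ⁅curve n u (k + 1), ⁅u, x⁆⁆ := by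
      rw [sum_eq_single (k + 1, 0)]
      · simp
      · rintro ⟨i, j⟩ hp hne
        rw [HasAntidiagonal.mem_antidiagonal] at hp
        have : j ≠ 0 := by rintro rfl; exact hne (by simpa using hp)
        simp [this]
      · intro hp
        exact absurd (HasAntidiagonal.mem_antidiagonal.2 (add_zero _)) hp
    have h6 : ∑ p ∈ antidiagonal (k + 1), ((k + 1).choose p.2 : ℂ) *
        (if p.1 = 0 then χ ⁅u, ⁅curve n u p.2, x⁆⁆ else 0) = χ ⁅curve n u (k + 1), ⁅u, x⁆⁆ := by
      rw [sum_eq_single (0, k + 1)]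
      · simp [h.lie_comm₁ hu (hq _) hx]
      · rintro ⟨i, j⟩ hp hne
        rw [HasAntidiagonal.mem_antidiagonal] at hp
        have : i ≠ 0 := by rintro rfl; exact hne (by simpa using hp)
        simp [this]
      · intro hp
        exact absurd (HasAntidiagonal.mem_antidiagonal.2 (zero_add _)) hp
    have h7 : ∑ p ∈ antidiagonal (k + 1), ((k + 1).choose p.2 : ℂ) *
        χ ⁅⁅curve n u p.1, n⁆, ⁅curve n u p.2, x⁆⁆ = ∑ p ∈ antidiagonal (k + 1),
        ((k + 1).choose p.1 : ℂ) * χ ⁅⁅curve n u p.1, n⁆, ⁅curve n u p.2, x⁆⁆ := by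
      refine sum_congr rfl fun p hp => ?_
      rw [Nat.choose_symm_of_eq_add (HasAntidiagonal.mem_antidiagonal.1 hp).symm]
    rw [sum_antidiagonal_choose_succ_mul
      (fun i j => χ ⁅curve n u i, ⁅curve n u j, x⁆⁆) (k + 1), h1]
    simp only [h2, h3, h4, mul_add, sum_add_distrib, h5, h6, h7]
    ring

open Finset in
/-- Exponentials of `N` and of `S₁` move `χ` in the same way, and the exponential series of an
element of `S₁` stops after the quadratic term. -/
theorem exists_sum_ad_pow (h : IsStabilizedTriangular χ N S₀ S₁ S₂) {K : ℕ}
    (hK : ∀ v ∈ N, (LieAlgebra.ad ℂ L v) ^ (K + 1) = 0) {v : L} (hv : v ∈ N) :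
    ∃ w ∈ S₁, ∀ x ∈ N, ∑ k ∈ range (K + 1),
      ((k.factorial : ℂ))⁻¹ * χ (((LieAlgebra.ad ℂ L v) ^ k) x) =
        χ x + χ ⁅w, x⁆ + (1 / 2 : ℂ) * χ ⁅w, ⁅w, x⁆⁆ := by
  obtain ⟨n, hn, u, hu, z, hz, rfl⟩ := h.exists_add hv
  have hq := h.curve_mem hn hu
  have hq0 : ∀ i, K + 2 ≤ i → curve n u i = 0 := fun i hi => curve_eq_zero (hK n (h.le₀ hn)) hi
  have hr : ∀ i, ((i.factorial : ℂ))⁻¹ • curve n u i ∈ S₁ := fun i => S₁.smul_mem _ (hq i)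
  refine ⟨∑ i ∈ range (K + 2), ((i.factorial : ℂ))⁻¹ • curve n u i,
    S₁.sum_mem fun i _ => hr i, fun x hx => ?_⟩
  have hterm : ∀ k, ((k.factorial : ℂ))⁻¹ * χ (((LieAlgebra.ad ℂ L (n + u + z)) ^ k) x) =
      (if k = 0 then χ x else 0) + χ ⁅((k.factorial : ℂ))⁻¹ • curve n u k, x⁆ +
        (1 / 2 : ℂ) * ∑ p ∈ antidiagonal k, χ ⁅((p.1.factorial : ℂ))⁻¹ • curve n u p.1,
          ⁅((p.2.factorial : ℂ))⁻¹ • curve n u p.2, x⁆⁆ := by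
    intro k
    cases k with
    | zero => simp [curve]
    | succ k =>
      rw [h.apply_ad_pow hn hu hz k hx, if_neg k.succ_ne_zero, zero_add, mul_add, smul_lie,
        map_smul, smul_eq_mul, mul_left_comm, mul_sum]
      congr 2
      refine sum_congr rfl fun p hp => ?_
      rw [HasAntidiagonal.mem_antidiagonal] at hp
      simp only [smul_lie, lie_smul, map_smul, smul_eq_mul]
      rw [← hp, Nat.cast_add_choose]
      have := Nat.factorial_ne_zero (p.1 + p.2)
      have : ((p.1 + p.2).factorial : ℂ) ≠ 0 := by exact_mod_cast this
      field_simp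
  have hlong : ∑ k ∈ range (K + 1),
      ((k.factorial : ℂ))⁻¹ * χ (((LieAlgebra.ad ℂ L (n + u + z)) ^ k) x) =
      ∑ k ∈ range (2 * (K + 2)),
        ((k.factorial : ℂ))⁻¹ * χ (((LieAlgebra.ad ℂ L (n + u + z)) ^ k) x) := by
    refine sum_subset (range_subset_range.2 (by omega)) fun k _ hk => ?_
    rw [mem_range, not_lt] at hk
    rw [pow_eq_zero_of_le hk (hK _ hv), LinearMap.zero_apply, map_zero, mul_zero]
  have hlin : ∑ k ∈ range (2 * (K + 2)), χ ⁅((k.factorial : ℂ))⁻¹ • curve n u k, x⁆ =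
      ∑ k ∈ range (K + 2), χ ⁅((k.factorial : ℂ))⁻¹ • curve n u k, x⁆ := by
    refine (sum_subset (range_subset_range.2 (by omega)) fun k _ hk => ?_).symm
    rw [mem_range, not_lt] at hk
    simp [hq0 k hk]
  rw [hlong, sum_congr rfl fun k _ => hterm k, sum_add_distrib, sum_add_distrib, ← mul_sum,
    sum_range_sum_antidiagonal_of_support (fun i j => χ ⁅((i.factorial : ℂ))⁻¹ • curve n u i,
      ⁅((j.factorial : ℂ))⁻¹ • curve n u j, x⁆⁆) (K + 2) _ le_rfl, hlin]
  · simp only [sum_lie, lie_sum, map_sum]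
    rw [sum_comm]
    congr 2
    simp
  · rintro i j (hi | hj)
    · simp [hq0 i hi]
    · simp [hq0 j hj]

open Finset in
theorem sum_ad_pow_of_mem₁ (h : IsStabilizedTriangular χ N S₀ S₁ S₂) {K : ℕ}
    (hK : ∀ v ∈ N, (LieAlgebra.ad ℂ L v) ^ (K + 1) = 0) {u : L} (hu : u ∈ S₁) {x : L}
    (hx : x ∈ N) : ∑ k ∈ range (K + 1),
      ((k.factorial : ℂ))⁻¹ * χ (((LieAlgebra.ad ℂ L u) ^ k) x) =
        χ x + χ ⁅u, x⁆ + (1 / 2 : ℂ) * χ ⁅u, ⁅u, x⁆⁆ := by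
  have h3 : ∀ k, 3 ≤ k → χ (((LieAlgebra.ad ℂ L u) ^ k) x) = 0 := by
    intro k hk
    obtain ⟨j, rfl⟩ := Nat.exists_eq_add_of_le hk
    rw [pow_add, Module.End.mul_apply]
    exact h.lie₁_lie₁_lie₁ hu hu hu (h.ad_pow_mem (h.le₁ hu) hx j)
  have h1 : ∑ k ∈ range (K + 1), ((k.factorial : ℂ))⁻¹ * χ (((LieAlgebra.ad ℂ L u) ^ k) x) =
      ∑ k ∈ range (K + 3), ((k.factorial : ℂ))⁻¹ * χ (((LieAlgebra.ad ℂ L u) ^ k) x) := by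
    refine sum_subset (range_subset_range.2 (by omega)) fun k _ hk => ?_
    rw [mem_range, not_lt] at hk
    rw [pow_eq_zero_of_le hk (hK _ (h.le₁ hu)), LinearMap.zero_apply, map_zero, mul_zero]
  have h2 : ∑ k ∈ range 3, ((k.factorial : ℂ))⁻¹ * χ (((LieAlgebra.ad ℂ L u) ^ k) x) =
      ∑ k ∈ range (K + 3), ((k.factorial : ℂ))⁻¹ * χ (((LieAlgebra.ad ℂ L u) ^ k) x) := by
    refine sum_subset (range_subset_range.2 (by omega)) fun k _ hk => ?_
    rw [mem_range, not_lt] at hk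
    rw [h3 k hk, mul_zero]
  rw [h1, ← h2]
  simp [sum_range_succ, pow_two]

end IsStabilizedTriangular

/-- The sum of the graded pieces of degree at least `m`. -/
abbrev degreeGE {L : Type*} [AddCommGroup L] [Module ℂ L] (gr : ℤ → Submodule ℂ L) (m : ℤ) :
    Submodule ℂ L :=
  ⨆ d : ℤ, ⨆ _ : m ≤ d, gr d

section Grading

variable {L : Type*} [LieRing L] [LieAlgebra ℂ L] {gr : ℤ → Submodule ℂ L}

theorem le_degreeGE {m i : ℤ} (h : m ≤ i) : gr i ≤ degreeGE gr m :=
  le_iSup₂_of_le i h le_rfl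

theorem degreeGE_le_iff {m : ℤ} {S : Submodule ℂ L} :
    degreeGE gr m ≤ S ↔ ∀ d, m ≤ d → gr d ≤ S :=
  iSup₂_le_iff

theorem degreeGE_anti {m m' : ℤ} (h : m' ≤ m) : degreeGE gr m ≤ degreeGE gr m' :=
  degreeGE_le_iff.2 fun _ hd => le_degreeGE (h.trans hd)

theorem degreeGE_eq_sup (m : ℤ) : degreeGE gr m = gr m ⊔ degreeGE gr (m + 1) := by
  refine le_antisymm (degreeGE_le_iff.2 fun d hd => ?_)
    (sup_le (le_degreeGE le_rfl) (degreeGE_anti (by omega)))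
  rcases hd.eq_or_lt with rfl | hd
  · exact le_sup_left
  · exact (le_degreeGE (by omega)).trans le_sup_right

theorem lie_mem_degreeGE
    (hbr : ∀ δ₁ δ₂ : ℤ, ∀ x ∈ gr δ₁, ∀ y ∈ gr δ₂, ⁅x, y⁆ ∈ gr (δ₁ + δ₂)) {m m' k : ℤ}
    (hk : k ≤ m + m') {x y : L} (hx : x ∈ degreeGE gr m) (hy : y ∈ degreeGE gr m') :
    ⁅x, y⁆ ∈ degreeGE gr k := by
  have h1 : ∀ i, m ≤ i → ∀ a ∈ gr i, ⁅a, y⁆ ∈ degreeGE gr k := by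
    intro i hi a ha
    have : degreeGE gr m' ≤ (degreeGE gr k).comap (LieAlgebra.ad ℂ L a : L →ₗ[ℂ] L) :=
      degreeGE_le_iff.2 fun j hj b hb =>
        le_degreeGE (by omega : k ≤ i + j) (hbr i j a ha b hb)
    exact this hy
  have : degreeGE gr m ≤ (degreeGE gr k).comap (LieAlgebra.ad ℂ L y : L →ₗ[ℂ] L) :=
    degreeGE_le_iff.2 fun i hi a ha => by
      rw [Submodule.mem_comap, LieAlgebra.ad_apply, ← lie_skew]
      exact Submodule.neg_mem _ (h1 i hi a ha)
  rw [← lie_skew]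
  exact Submodule.neg_mem _ (this hx)

/-- The derivation that multiplies every homogeneous element by its degree. -/
theorem exists_degree_derivation (hdec : DirectSum.IsInternal fun δ : ℤ => gr δ)
    (hbr : ∀ δ₁ δ₂ : ℤ, ∀ x ∈ gr δ₁, ∀ y ∈ gr δ₂, ⁅x, y⁆ ∈ gr (δ₁ + δ₂)) :
    ∃ D : LieDerivation ℂ L L, ∀ i, ∀ x ∈ gr i, D x = (i : ℂ) • x := by
  classical
  let e := LinearEquiv.ofBijective (DirectSum.coeLinearMap fun δ : ℤ => gr δ) hdec
  let T : L →ₗ[ℂ] L :=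
    (DirectSum.toModule ℂ ℤ L fun i : ℤ => (i : ℂ) • (gr i).subtype) ∘ₗ (e.symm : L →ₗ[ℂ] _)
  have hT : ∀ i, ∀ x ∈ gr i, T x = (i : ℂ) • x := by
    intro i x hx
    have : e.symm x = DirectSum.lof ℂ ℤ (fun δ : ℤ => gr δ) i ⟨x, hx⟩ := by
      rw [LinearEquiv.symm_apply_eq]
      exact (DirectSum.coeLinearMap_lof (fun δ : ℤ => gr δ) i ⟨x, hx⟩).symm
    simp [T, this]
  have hspan : ∀ x : L, x ∈ ⨆ i, gr i := by
    intro x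
    rw [hdec.submodule_iSup_eq_top]
    trivial
  have hleib : ∀ x y, T ⁅x, y⁆ = ⁅x, T y⁆ - ⁅y, T x⁆ := by
    intro x y
    induction hspan x using Submodule.iSup_induction' with
    | zero => simp
    | add a b _ _ ha hb => simp only [add_lie, map_add, lie_add, ha, hb]; abel
    | mem i a ha =>
      induction hspan y using Submodule.iSup_induction' with
      | zero => simp
      | add b c _ _ hb hc => simp only [add_lie, map_add, lie_add, hb, hc]; abel
      | mem j b hb =>
        rw [hT _ _ (hbr i j a ha b hb), hT i a ha, hT j b hb, lie_smul, lie_smul,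
          ← lie_skew a b, smul_neg, smul_neg, Int.cast_add, add_smul]
        abel
  exact ⟨⟨T, hleib⟩, hT⟩

variable [FiniteDimensional ℂ L] [LieAlgebra.IsKilling ℂ L] {Φ : L →ₗ[ℂ] L →ₗ[ℂ] ℂ}

/-- An invariant form pairs only opposite degrees of a grading. -/
theorem apply_eq_zero_of_mem_grading (hinv : ∀ x y z : L, Φ ⁅x, y⁆ z = Φ x ⁅y, z⁆)
    (hdec : DirectSum.IsInternal fun δ : ℤ => gr δ)
    (hbr : ∀ δ₁ δ₂ : ℤ, ∀ x ∈ gr δ₁, ∀ y ∈ gr δ₂, ⁅x, y⁆ ∈ gr (δ₁ + δ₂)) {i j : ℤ}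
    (hij : i + j ≠ 0) {x y : L} (hx : x ∈ gr i) (hy : y ∈ gr j) : Φ x y = 0 := by
  obtain ⟨D, hD⟩ := exists_degree_derivation hdec hbr
  obtain ⟨h, rfl⟩ := LieDerivation.IsKilling.exists_eq_ad D
  simp only [LieDerivation.ad_apply_apply] at hD
  have key := hinv x h y
  rw [← lie_skew, hD i x hx, hD j y hy] at key
  simp only [map_neg, map_smul, LinearMap.neg_apply, LinearMap.smul_apply, smul_eq_mul] at key
  have hne : ((i : ℂ) + j) ≠ 0 := by exact_mod_cast hij
  refine (mul_eq_zero.1 ?_).resolve_left hne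
  linear_combination -key

theorem apply_eq_zero_of_mem_degreeGE (hinv : ∀ x y z : L, Φ ⁅x, y⁆ z = Φ x ⁅y, z⁆)
    (hdec : DirectSum.IsInternal fun δ : ℤ => gr δ)
    (hbr : ∀ δ₁ δ₂ : ℤ, ∀ x ∈ gr δ₁, ∀ y ∈ gr δ₂, ⁅x, y⁆ ∈ gr (δ₁ + δ₂)) {i m : ℤ}
    (him : 0 < i + m) {x y : L} (hx : x ∈ gr i) (hy : y ∈ degreeGE gr m) : Φ x y = 0 := by
  have : degreeGE gr m ≤ LinearMap.ker (Φ x) :=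
    degreeGE_le_iff.2 fun j hj b hb =>
      apply_eq_zero_of_mem_grading hinv hdec hbr (by omega : i + j ≠ 0) hx hb
  exact this hy

end Grading

/-- Under the conditions (★), the orbit `Õ₂` decomposes as
`Õ₂ = {Σ_{k=0}^{2} (1/k!) ad*(v)^k χ̃₂ : v ∈ g_{1,0} ⊕ g_{1,1}} ⊕ ad*(g_{1,2}) χ̃₂`;
equivalently, for `v ∈ g_{1,0} ⊕ g_{1,1}` and `w ∈ g_{1,2}` one has
`ad*(v + w)² χ̃₂ = ad*(v)² χ̃₂`.  As before, `ad*(v)ξ = -ξ ∘ ad v` and orbits of the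
unipotent group `Ñ₂` are realized through exponentials of the coadjoint action. -/
theorem statement14
    (g : Type*) [LieRing g] [LieAlgebra ℂ g] [FiniteDimensional ℂ g]
    [LieAlgebra.IsSimple ℂ g]
    (Φ : g →ₗ[ℂ] g →ₗ[ℂ] ℂ)
    (hsymm : ∀ x y : g, Φ x y = Φ y x)
    (hinv : ∀ x y z : g, Φ ⁅x, y⁆ z = Φ x ⁅y, z⁆)
    (hnondeg : ∀ x : g, (∀ y : g, Φ x y = 0) → x = 0)
    (gr1 gr2 : ℤ → Submodule ℂ g)
    (hdec1 : DirectSum.IsInternal fun δ : ℤ => gr1 δ)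
    (hdec2 : DirectSum.IsInternal fun δ : ℤ => gr2 δ)
    (hbidec : DirectSum.IsInternal fun p : ℤ × ℤ => gr1 p.1 ⊓ gr2 p.2)
    (hbr1 : ∀ δ₁ δ₂ : ℤ, ∀ x ∈ gr1 δ₁, ∀ y ∈ gr1 δ₂, ⁅x, y⁆ ∈ gr1 (δ₁ + δ₂))
    (hbr2 : ∀ δ₁ δ₂ : ℤ, ∀ x ∈ gr2 δ₁, ∀ y ∈ gr2 δ₂, ⁅x, y⁆ ∈ gr2 (δ₁ + δ₂))
    (f1 f2 : g) (hf1 : f1 ∈ gr1 (-2)) (hf2 : f2 ∈ gr2 (-2))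
    (hgood1inj : ∀ δ : ℤ, 1 ≤ δ → ∀ x ∈ gr1 δ, ⁅f1, x⁆ = 0 → x = 0)
    (hgood1surj : ∀ δ : ℤ, δ ≤ 1 → ∀ y ∈ gr1 (δ - 2), ∃ x ∈ gr1 δ, ⁅f1, x⁆ = y)
    (hgood2inj : ∀ δ : ℤ, 1 ≤ δ → ∀ x ∈ gr2 δ, ⁅f2, x⁆ = 0 → x = 0)
    (hgood2surj : ∀ δ : ℤ, δ ≤ 1 → ∀ y ∈ gr2 (δ - 2), ∃ x ∈ gr2 δ, ⁅f2, x⁆ = y)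
    (hstar1 : (⨆ d : ℤ, ⨆ _ : (2 : ℤ) ≤ d, gr1 d) ≤ ⨆ d : ℤ, ⨆ _ : (1 : ℤ) ≤ d, gr2 d)
    (hstar2 : (⨆ d : ℤ, ⨆ _ : (1 : ℤ) ≤ d, gr2 d) ≤ ⨆ d : ℤ, ⨆ _ : (0 : ℤ) ≤ d, gr1 d)
    (hstar3 : gr1 1 ≤ (gr1 1 ⊓ gr2 0) ⊔ (gr1 1 ⊓ gr2 1) ⊔ (gr1 1 ⊓ gr2 2))
    (hstar4 : gr2 1 ≤ (gr2 1 ⊓ gr1 0) ⊔ (gr2 1 ⊓ gr1 1) ⊔ (gr2 1 ⊓ gr1 2))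
    (hstar5 : f2 - f1 ∈ gr1 0 ⊓ gr2 (-2))
    (aa : Submodule ℂ g)
    (ha1 : aa ≤ (gr2 1 ⊓ gr1 0) ⊓ LinearMap.ker (LieAlgebra.ad ℂ g f1 : g →ₗ[ℂ] g))
    (ha2 : ∀ u ∈ aa ⊔ (gr2 1 ⊓ gr1 2), ∀ v ∈ aa ⊔ (gr2 1 ⊓ gr1 2), Φ f2 ⁅u, v⁆ = 0)
    (ha3 : {v : g | v ∈ gr2 1 ∧ ∀ u ∈ aa ⊔ (gr2 1 ⊓ gr1 2), Φ f2 ⁅v, u⁆ = 0}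
        = ↑(aa ⊔ (gr2 1 ⊓ gr1 1) ⊔ (gr2 1 ⊓ gr1 2)))
    (n0 n1 n2 : Submodule ℂ g)
    (hn0 : n0 = aa ⊔ (gr1 0 ⊓ (⨆ d : ℤ, ⨆ _ : (2 : ℤ) ≤ d, gr2 d)))
    (hn1 : n1 = ((gr1 1 ⊓ gr2 1) ⊔ (gr1 1 ⊓ gr2 2)) ⊔ (⨆ d : ℤ, ⨆ _ : (2 : ℤ) ≤ d, gr1 d))
    (hn2 : n2 = (aa ⊔ (gr1 1 ⊓ gr2 1) ⊔ (gr1 2 ⊓ gr2 1)) ⊔ (⨆ d : ℤ, ⨆ _ : (2 : ℤ) ≤ d, gr2 d))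
    (nt1 nt2 : Submodule ℂ g)
    (hnt1 : nt1 = ⨆ d : ℤ, ⨆ _ : (1 : ℤ) ≤ d, gr1 d)
    (hnt2 : nt2 = nt1 ⊔ n0)
    (K : ℕ) (hK : ∀ v ∈ nt2, (LieAlgebra.ad ℂ g v : Module.End ℂ g) ^ (K + 1) = 0) :
    let F : g → Module.Dual ℂ g := fun v =>
      ∑ k ∈ Finset.range (K + 1), ((-1 : ℂ) ^ k * ((k.factorial : ℂ))⁻¹) •
        ((Φ f2) ∘ₗ ((LieAlgebra.ad ℂ g v : Module.End ℂ g) ^ k : g →ₗ[ℂ] g))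
    let G : g → Module.Dual ℂ g := fun v =>
      ∑ k ∈ Finset.range 3, ((-1 : ℂ) ^ k * ((k.factorial : ℂ))⁻¹) •
        ((Φ f2) ∘ₗ ((LieAlgebra.ad ℂ g v : Module.End ℂ g) ^ k : g →ₗ[ℂ] g))
    let r2 : Module.Dual ℂ g →ₗ[ℂ] Module.Dual ℂ nt2 := LinearMap.dualMap nt2.subtype
    -- `ad*(v + w)² χ̃₂ = ad*(v)² χ̃₂`
    (∀ v ∈ (gr1 1 ⊓ gr2 0) ⊔ (gr1 1 ⊓ gr2 1), ∀ w ∈ gr1 1 ⊓ gr2 2,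
      r2 ((Φ f2) ∘ₗ (((LieAlgebra.ad ℂ g (v + w) : Module.End ℂ g) ^ 2) : g →ₗ[ℂ] g))
        = r2 ((Φ f2) ∘ₗ (((LieAlgebra.ad ℂ g v : Module.End ℂ g) ^ 2) : g →ₗ[ℂ] g))) ∧
    -- the orbit decomposition
    ({ξ : Module.Dual ℂ nt2 | ∃ v ∈ nt2, ξ = r2 (F v)}
      = {ξ : Module.Dual ℂ nt2 | ∃ v ∈ (gr1 1 ⊓ gr2 0) ⊔ (gr1 1 ⊓ gr2 1),
          ∃ w ∈ gr1 1 ⊓ gr2 2,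
          ξ = r2 (G v) +
            r2 (-((Φ f2) ∘ₗ (LieAlgebra.ad ℂ g w : g →ₗ[ℂ] g)))}) := by
  intro F G r2
  change degreeGE gr1 2 ≤ degreeGE gr2 1 at hstar1
  change n0 = aa ⊔ (gr1 0 ⊓ degreeGE gr2 2) at hn0
  change nt1 = degreeGE gr1 1 at hnt1
  obtain ⟨hd1, -⟩ := hstar5
  have hsplit : ∀ x, Φ f2 x = Φ f1 x + Φ (f2 - f1) x := fun x => by simp
  have kill1 : ∀ x ∈ degreeGE gr1 3, Φ f2 x = 0 := fun x hx => by
    rw [hsplit, apply_eq_zero_of_mem_degreeGE hinv hdec1 hbr1 (by norm_num) hf1 hx,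
      apply_eq_zero_of_mem_degreeGE hinv hdec1 hbr1 (by norm_num) hd1 hx, add_zero]
  have kill1' : ∀ x ∈ gr1 1, Φ f2 x = 0 := fun x hx => by
    rw [hsplit, apply_eq_zero_of_mem_grading hinv hdec1 hbr1 (by norm_num) hf1 hx,
      apply_eq_zero_of_mem_grading hinv hdec1 hbr1 (by norm_num) hd1 hx, add_zero]
  have kill2 : ∀ x ∈ degreeGE gr2 3, Φ f2 x = 0 := fun x hx =>
    apply_eq_zero_of_mem_degreeGE hinv hdec2 hbr2 (by norm_num) hf2 hx
  have haa0 : aa ≤ gr1 0 := ha1.trans (inf_le_left.trans inf_le_right)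
  have haa1 : aa ≤ gr2 1 := ha1.trans (inf_le_left.trans inf_le_left)
  have haaf : ∀ a ∈ aa, ⁅f1, a⁆ = 0 := fun a ha => (ha1 ha).2
  have hn00 : n0 ≤ gr1 0 := hn0 ▸ sup_le haa0 inf_le_left
  have hn01 : n0 ≤ degreeGE gr2 1 := hn0 ▸ sup_le (haa1.trans (le_degreeGE le_rfl))
    (inf_le_right.trans (degreeGE_anti (by norm_num)))
  have hnt2' : nt2 = n0 ⊔ gr1 1 ⊔ degreeGE gr1 2 := by
    rw [hnt2, hnt1, degreeGE_eq_sup, one_add_one_eq_two, sup_comm, sup_assoc]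
  have hS1 : gr1 1 ≤ degreeGE gr1 1 := le_degreeGE le_rfl
  have hS0 : n0 ≤ degreeGE gr1 0 := hn00.trans (le_degreeGE le_rfl)
  have hn0lie : ∀ x ∈ n0, ∀ y ∈ n0, Φ f2 ⁅x, y⁆ = 0 := by
    intro x hx y hy
    obtain ⟨a, ha, b, hb, rfl⟩ := Submodule.mem_sup.1 (hn0 ▸ hx)
    obtain ⟨a', ha', b', hb', rfl⟩ := Submodule.mem_sup.1 (hn0 ▸ hy)
    rw [add_lie, lie_add a, map_add, map_add,
      ha2 a (Submodule.mem_sup_left ha) a' (Submodule.mem_sup_left ha'),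
      kill2 _ (lie_mem_degreeGE hbr2 (by norm_num) (le_degreeGE le_rfl (haa1 ha)) hb'.2),
      kill2 _ (lie_mem_degreeGE hbr2 (by norm_num) hb.2 (hn01 hy)), add_zero, add_zero]
  have hn0two : ∀ x ∈ degreeGE gr1 2, ∀ y ∈ n0, Φ f2 ⁅x, y⁆ = 0 := by
    intro x hx y hy
    obtain ⟨a, ha, b, hb, rfl⟩ := Submodule.mem_sup.1 (hn0 ▸ hy)
    rw [lie_add, map_add, kill2 ⁅x, b⁆ (lie_mem_degreeGE hbr2 (by norm_num) (hstar1 hx) hb.2),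
      add_zero, hsplit, apply_eq_zero_of_mem_degreeGE hinv hdec1 hbr1 (by norm_num) hd1
        (lie_mem_degreeGE hbr1 le_rfl hx (le_degreeGE le_rfl (haa0 ha))), add_zero,
      ← lie_skew, map_neg, ← hinv, haaf a ha, map_zero, LinearMap.zero_apply, neg_zero]
  have hswap : ∀ x y : g, Φ f2 ⁅x, y⁆ = - Φ f2 ⁅y, x⁆ := fun x y => by
    rw [← lie_skew, map_neg]
  have hT : IsStabilizedTriangular (Φ f2) nt2 n0 (gr1 1) (degreeGE gr1 2) := by
    refine ⟨hnt2'.symm, ?_, ?_, ?_, ?_, ?_, ?_, ?_, ?_⟩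
    · intro x hx y hy
      rw [hn0]
      exact Submodule.mem_sup_right ⟨hbr1 0 0 x (hn00 hx) y (hn00 hy),
        lie_mem_degreeGE hbr2 (by norm_num) (hn01 hx) (hn01 hy)⟩
    · exact fun x hx y hy => hbr1 1 0 x hx y (hn00 hy)
    · exact fun x hx y hy => lie_mem_degreeGE hbr1 (by norm_num) hx (hS0 hy)
    · exact fun x hx y hy => lie_mem_degreeGE hbr1 (by norm_num) (hS1 hx) (hS1 hy)
    · exact fun x hx y hy => lie_mem_degreeGE hbr1 (by norm_num) (hS1 hx) hy
    · exact fun x hx y hy => lie_mem_degreeGE hbr1 (by norm_num) hx hy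
    · intro x hx y hy
      rw [hnt2', sup_assoc] at hy
      obtain ⟨a, ha, t, ht, rfl⟩ := Submodule.mem_sup.1 hy
      obtain ⟨b, hb, c, hc, rfl⟩ := Submodule.mem_sup.1 ht
      rw [lie_add, lie_add, map_add, map_add, hn0lie x hx a ha,
        kill1' _ (hbr1 0 1 x (hn00 hx) b hb), hswap, hn0two c hc x hx, neg_zero, add_zero,
        add_zero]
    · intro x hx y hy
      rw [hnt2, hnt1] at hy
      obtain ⟨b, hb, a, ha, rfl⟩ := Submodule.mem_sup.1 hy
      rw [lie_add, map_add, hn0two x hx a ha,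
        kill1 _ (lie_mem_degreeGE hbr1 (by norm_num) hx hb), add_zero]
  have hsq : ∀ v ∈ (gr1 1 ⊓ gr2 0) ⊔ (gr1 1 ⊓ gr2 1), ∀ w ∈ gr1 1 ⊓ gr2 2, ∀ x ∈ nt2,
      Φ f2 ⁅v + w, ⁅v + w, x⁆⁆ = Φ f2 ⁅v, ⁅v, x⁆⁆ := by
    intro v hv w hw x hx
    have hv1 : v ∈ gr1 1 := (sup_le inf_le_left inf_le_left : _ ≤ gr1 1) hv
    have hv2 : v ∈ degreeGE gr2 0 := (sup_le (inf_le_right.trans (le_degreeGE le_rfl))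
      (inf_le_right.trans (le_degreeGE zero_le_one)) : _ ≤ degreeGE gr2 0) hv
    have hw2 : w ∈ degreeGE gr2 2 := le_degreeGE le_rfl hw.2
    have key : ∀ t, t ∈ gr1 1 → t ∈ degreeGE gr2 0 → Φ f2 ⁅w, ⁅t, x⁆⁆ = 0 := by
      intro t ht1 ht2
      rw [hnt2, hnt1] at hx
      obtain ⟨b, hb, a, ha, rfl⟩ := Submodule.mem_sup.1 hx
      rw [lie_add, lie_add, map_add,
        kill1 _ (lie_mem_degreeGE hbr1 (by norm_num) (hS1 hw.1)
          (lie_mem_degreeGE hbr1 le_rfl (hS1 ht1) hb)),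
        kill2 _ (lie_mem_degreeGE hbr2 (by norm_num) hw2
          (lie_mem_degreeGE hbr2 le_rfl ht2 (hn01 ha))), add_zero]
    simp only [add_lie, lie_add, map_add, hT.lie_comm₁ hv1 hw.1 hx, key v hv1 hv2,
      key w hw.1 (degreeGE_anti (by norm_num) hw2), add_zero]
  have hF : ∀ v x, F v x = ∑ k ∈ Finset.range (K + 1),
      ((k.factorial : ℂ))⁻¹ * Φ f2 (((LieAlgebra.ad ℂ g (-v)) ^ k) x) := by
    intro v x
    simp only [F, LinearMap.sum_apply, LinearMap.smul_apply, LinearMap.comp_apply, smul_eq_mul]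
    refine Finset.sum_congr rfl fun k _ => ?_
    have hpow : (LieAlgebra.ad ℂ g (-v)) ^ k = (-1 : ℂ) ^ k • (LieAlgebra.ad ℂ g v) ^ k := by
      rw [← smul_pow, neg_one_smul, map_neg]
    rw [hpow, LinearMap.smul_apply, map_smul, smul_eq_mul]
    ring
  have hG : ∀ v x, G v x = Φ f2 x - Φ f2 ⁅v, x⁆ + (1 / 2 : ℂ) * Φ f2 ⁅v, ⁅v, x⁆⁆ := by
    intro v x
    simp [G, Finset.sum_range_succ, pow_two, sub_eq_add_neg]
  have hmem : ∀ v ∈ (gr1 1 ⊓ gr2 0) ⊔ (gr1 1 ⊓ gr2 1), ∀ w ∈ gr1 1 ⊓ gr2 2,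
      v + w ∈ gr1 1 := fun v hv w hw =>
    (gr1 1).add_mem ((sup_le inf_le_left inf_le_left : _ ≤ gr1 1) hv) hw.1
  refine ⟨fun v hv w hw => ?_, Set.ext fun ξ => ⟨?_, ?_⟩⟩
  · ext ⟨x, hx⟩
    simp only [pow_two]
    exact hsq v hv w hw x hx
  · rintro ⟨v, hv, rfl⟩
    obtain ⟨w, hw, hsum⟩ := hT.exists_sum_ad_pow hK (nt2.neg_mem hv)
    obtain ⟨a, ha, b, hb, hab⟩ := Submodule.mem_sup.1 (hstar3 ((gr1 1).neg_mem hw))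
    obtain rfl : w = -(a + b) := by rw [hab, neg_neg]
    refine ⟨a, ha, b, hb, ?_⟩
    ext ⟨x, hx⟩
    have h1 := hsum x hx
    simp only [neg_lie, lie_neg, neg_neg] at h1
    rw [hsq a ha b hb x hx, ← hF] at h1
    simp only [r2, LinearMap.add_apply, LinearMap.dualMap_apply, Submodule.subtype_apply, h1, hG,
      LinearMap.neg_apply, LinearMap.comp_apply, LieAlgebra.ad_apply, add_lie, map_neg, map_add]
    ring
  · rintro ⟨a, ha, b, hb, rfl⟩
    refine ⟨a + b, hT.le₁ (hmem a ha b hb), ?_⟩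
    ext ⟨x, hx⟩
    have h1 := hT.sum_ad_pow_of_mem₁ hK ((gr1 1).neg_mem (hmem a ha b hb)) hx
    simp only [neg_lie, lie_neg, neg_neg] at h1
    rw [hsq a ha b hb x hx, ← hF] at h1
    simp only [r2, LinearMap.add_apply, LinearMap.dualMap_apply, Submodule.subtype_apply, h1, hG,
      LinearMap.neg_apply, LinearMap.comp_apply, LieAlgebra.ad_apply, add_lie, map_neg, map_add]
    ring
end

section
/- Under conditions (★), with π₂ : g* → n₂* and π̃₂ : g* → ñ₂* the restriction maps, O₂^- = -Ad*(N₂)χ̄₂ and Õ₂^- = -Ad*(Ñ₂)χ̃₂: the fiber inclusion π₂⁻¹(O₂^-) ⊆ π̃₂⁻¹(Õ₂^-) holds. Explicitly, n₂^⊥ = ñ₂^⊥ ⊕ ad*(g_{1,2})χ₂, π₂⁻¹(O₂^-) = -χ₂ + ad*(g_{1,1})χ₂ ⊕ n₂^⊥, and π̃₂⁻¹(Õ₂^-) = { -χ₂ - ad*(v)χ₂ - ad*(w)χ₂ - (1/2)ad*(v+w)²χ₂ : v ∈ g_{1,0}, w ∈ g_{1,1} } ⊕ n₂^⊥. -/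
theorem exists_lie_eq_smul_of_grading {K L : Type*} [Field K] [LieRing L] [LieAlgebra K L]
    [FiniteDimensional K L] [LieAlgebra.IsKilling K L] (gr : ℤ → Submodule K L)
    (hdec : DirectSum.IsInternal gr)
    (hbr : ∀ i j, ∀ x ∈ gr i, ∀ y ∈ gr j, ⁅x, y⁆ ∈ gr (i + j)) :
    ∃ h : L, ∀ i, ∀ x ∈ gr i, ⁅h, x⁆ = (i : K) • x := by
  classical
  let e := LinearEquiv.ofBijective (DirectSum.coeLinearMap gr) hdec
  let D : L →ₗ[K] L :=
    DirectSum.toModule K ℤ L (fun i => (i : K) • (gr i).subtype) ∘ₗ e.symm.toLinearMap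
  have hD : ∀ i, ∀ x ∈ gr i, D x = (i : K) • x := by
    intro i x hx
    have : e.symm x = DirectSum.lof K ℤ (fun i => gr i) i ⟨x, hx⟩ := by
      rw [LinearEquiv.symm_apply_eq]
      exact (DirectSum.coeLinearMap_lof gr i ⟨x, hx⟩).symm
    simp [D, this]
  have htop : ∀ x : L, x ∈ ⨆ i, gr i := fun x => by
    rw [hdec.submodule_iSup_eq_top]; trivial
  have hleib : ∀ x y : L, D ⁅x, y⁆ = ⁅x, D y⁆ - ⁅y, D x⁆ := by
    intro x y
    induction htop x using Submodule.iSup_induction' with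
    | mem i x hx =>
      induction htop y using Submodule.iSup_induction' with
      | mem j y hy =>
        rw [hD _ _ (hbr i j x hx y hy), hD _ _ hx, hD _ _ hy, lie_smul, lie_smul,
          ← lie_skew x y, smul_neg, smul_neg]
        push_cast
        module
      | zero => simp
      | add y z _ _ h1 h2 => simp only [lie_add, add_lie, map_add, h1, h2]; abel
    | zero => simp
    | add x z _ _ h1 h2 => simp only [lie_add, add_lie, map_add, h1, h2]; abel
  obtain ⟨h, hh⟩ := LieDerivation.IsKilling.exists_eq_ad (⟨D, hleib⟩ : LieDerivation K L L)
  refine ⟨h, fun i x hx => ?_⟩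
  rw [← hD i x hx]
  simpa using congrArg (fun d : LieDerivation K L L => d x) hh

theorem invariant_form_apply_eq_zero_of_grading {K L : Type*} [Field K] [CharZero K] [LieRing L]
    [LieAlgebra K L] [FiniteDimensional K L] [LieAlgebra.IsKilling K L] (Φ : L →ₗ[K] L →ₗ[K] K)
    (hinv : ∀ x y z : L, Φ ⁅x, y⁆ z = Φ x ⁅y, z⁆) (gr : ℤ → Submodule K L)
    (hdec : DirectSum.IsInternal gr)
    (hbr : ∀ i j, ∀ x ∈ gr i, ∀ y ∈ gr j, ⁅x, y⁆ ∈ gr (i + j))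
    {i j : ℤ} (hij : i + j ≠ 0) {x y : L} (hx : x ∈ gr i) (hy : y ∈ gr j) : Φ x y = 0 := by
  obtain ⟨h, hh⟩ := exists_lie_eq_smul_of_grading gr hdec hbr
  have h1 := hinv x h y
  rw [← lie_skew, hh i x hx, hh j y hy] at h1
  simp only [map_neg, map_smul, LinearMap.neg_apply, LinearMap.smul_apply, smul_eq_mul] at h1
  have h2 : ((i + j : ℤ) : K) * Φ x y = 0 := by push_cast; linear_combination -h1
  exact (mul_eq_zero.mp h2).resolve_left (by exact_mod_cast hij)

theorem le_iSup_of_refines_grading {K L P : Type*} [Field K] [AddCommGroup L] [Module K L]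
    (gr : ℤ → Submodule K L) (hind : iSupIndep gr) (B : P → Submodule K L) (f : P → ℤ)
    (hB : ∀ p, B p ≤ gr (f p)) (htop : ⨆ p, B p = ⊤) (i : ℤ) :
    gr i ≤ ⨆ p, ⨆ _ : f p = i, B p := by
  intro x hx
  have hle : (⊤ : Submodule K L) ≤ (⨆ p, ⨆ _ : f p = i, B p) ⊔ ⨆ k, ⨆ _ : k ≠ i, gr k := by
    rw [← htop]
    refine iSup_le fun p => ?_
    by_cases hp : f p = i
    · exact le_sup_of_le_left (le_iSup₂_of_le p hp le_rfl)
    · exact le_sup_of_le_right ((hB p).trans (le_iSup₂_of_le (f p) hp le_rfl))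
  obtain ⟨y, hy, z, hz, rfl⟩ := Submodule.mem_sup.mp (hle (Submodule.mem_top (x := x)))
  have hyi : y ∈ gr i := (iSup₂_le fun p hp => hp ▸ hB p : (⨆ p, ⨆ _ : f p = i, B p) ≤ gr i) hy
  have hzi : z ∈ gr i := by simpa using sub_mem hx hyi
  have hz0 : z = 0 := Submodule.disjoint_def.mp (hind i) z hzi hz
  simpa [hz0] using hy

theorem eq_zero_of_mem_grading_of_mem_iSup {K L : Type*} [Field K] [AddCommGroup L] [Module K L]
    {gr : ℤ → Submodule K L} (hind : iSupIndep gr) {x : L} {j : ℤ} (hx : x ∈ gr j) (S : Set ℤ)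
    (hS : x ∈ ⨆ i ∈ S, gr i) (hj : j ∉ S) : x = 0 :=
  Submodule.disjoint_def.mp (hind.disjoint_biSup hj) x hx hS

theorem dualMap_subtype_eq_iff {K L : Type*} [Field K] [AddCommGroup L] [Module K L]
    (W : Submodule K L) (ξ η : Module.Dual K L) :
    LinearMap.dualMap W.subtype ξ = LinearMap.dualMap W.subtype η ↔
      ξ - η ∈ W.dualAnnihilator := by
  rw [LinearMap.ext_iff, Submodule.mem_dualAnnihilator]
  simp [sub_eq_zero]

/-- The sum of the bihomogeneous pieces whose bidegree satisfies `P`. -/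
def bigradedSum {L : Type*} [LieRing L] [LieAlgebra ℂ L] (gr1 gr2 : ℤ → Submodule ℂ L)
    (P : ℤ → ℤ → Prop) : Submodule ℂ L :=
  ⨆ p : ℤ × ℤ, ⨆ _ : P p.1 p.2, gr1 p.1 ⊓ gr2 p.2

/-- The bidegrees allowed by the conditions (★). -/
def StarSupport (i j : ℤ) : Prop :=
  (2 ≤ i → 1 ≤ j) ∧ (1 ≤ j → 0 ≤ i) ∧ (i = 1 → 0 ≤ j ∧ j ≤ 2) ∧ (j = 1 → 0 ≤ i ∧ i ≤ 2)

/-- The properties of a pair of gradings, a linear form `χ` and a subspace `aa` of `g_{0,1}` from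
which the coadjoint orbit of `χ` is computed. -/
structure StarGrading {L : Type*} [LieRing L] [LieAlgebra ℂ L] (gr1 gr2 : ℤ → Submodule ℂ L)
    (χ : Module.Dual ℂ L) (aa : Submodule ℂ L) : Prop where
  lie_mem₁ : ∀ i j : ℤ, ∀ x ∈ gr1 i, ∀ y ∈ gr1 j, ⁅x, y⁆ ∈ gr1 (i + j)
  lie_mem₂ : ∀ i j : ℤ, ∀ x ∈ gr2 i, ∀ y ∈ gr2 j, ⁅x, y⁆ ∈ gr2 (i + j)
  starSupport : ∀ i j : ℤ, ∀ x ∈ gr1 i, x ∈ gr2 j → x ≠ 0 → StarSupport i j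
  χ_eq_zero : ∀ i j : ℤ, ∀ x ∈ gr1 i, x ∈ gr2 j → ¬((i = 0 ∨ i = 2) ∧ j = 2) → χ x = 0
  aa_le : aa ≤ gr1 0 ⊓ gr2 1
  χ_lie_aa_aa : ∀ x ∈ aa, ∀ y ∈ aa, χ ⁅x, y⁆ = 0
  χ_lie_aa : ∀ x ∈ aa, ∀ y ∈ gr1 2 ⊓ gr2 1, χ ⁅x, y⁆ = 0

/-- The truncated exponential series of the coadjoint action of `v` on `χ`. -/
noncomputable def coadExp {L : Type*} [LieRing L] [LieAlgebra ℂ L] (χ : Module.Dual ℂ L) (n : ℕ)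
    (v : L) : Module.Dual ℂ L :=
  ∑ k ∈ Finset.range n, ((-1 : ℂ) ^ k * ((k.factorial : ℂ))⁻¹) •
    (χ ∘ₗ ((LieAlgebra.ad ℂ L v : Module.End ℂ L) ^ k : L →ₗ[ℂ] L))

theorem coadExp_apply_eq_sum {L : Type*} [LieRing L] [LieAlgebra ℂ L] {χ : Module.Dual ℂ L} {n : ℕ}
    {v : L} (hv : (LieAlgebra.ad ℂ L v : Module.End ℂ L) ^ n = 0) {x : L} (m : ℕ)
    (hx : ∀ k, m ≤ k → χ (((LieAlgebra.ad ℂ L v : Module.End ℂ L) ^ k) x) = 0) :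
    coadExp χ n v x = ∑ k ∈ Finset.range m, ((-1 : ℂ) ^ k * ((k.factorial : ℂ))⁻¹) *
      χ (((LieAlgebra.ad ℂ L v : Module.End ℂ L) ^ k) x) := by
  have h1 : coadExp χ n v x = ∑ k ∈ Finset.range n, ((-1 : ℂ) ^ k * ((k.factorial : ℂ))⁻¹) *
      χ (((LieAlgebra.ad ℂ L v : Module.End ℂ L) ^ k) x) := by
    simp [coadExp, LinearMap.sum_apply]
  rw [h1]
  rcases le_total n m with h | h
  · refine Finset.sum_subset (Finset.range_mono h) fun k _ hk => ?_
    rw [pow_eq_zero_of_le (by simpa using hk) hv]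
    simp
  · refine (Finset.sum_subset (Finset.range_mono h) fun k _ hk => ?_).symm
    rw [hx k (by simpa using hk), mul_zero]

namespace StarGrading

variable {L : Type*} [LieRing L] [LieAlgebra ℂ L] {gr1 gr2 : ℤ → Submodule ℂ L}
  {χ : Module.Dual ℂ L} {aa : Submodule ℂ L} {P Q R : ℤ → ℤ → Prop}

local notation "𝒰" => bigradedSum gr1 gr2

theorem inf_le_bigradedSum {i j : ℤ} (h : P i j) : gr1 i ⊓ gr2 j ≤ 𝒰 P :=
  le_iSup₂_of_le (i, j) h le_rfl

theorem bigradedSum_le (H : StarGrading gr1 gr2 χ aa) {M : Submodule ℂ L}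
    (h : ∀ i j, StarSupport i j → P i j → gr1 i ⊓ gr2 j ≤ M) : 𝒰 P ≤ M := by
  refine iSup₂_le fun p hp x hx => ?_
  by_cases h0 : x = 0
  · simp [h0]
  · exact h _ _ (H.starSupport _ _ x hx.1 hx.2 h0) hp hx

theorem bigradedSum_mono (H : StarGrading gr1 gr2 χ aa)
    (h : ∀ i j, StarSupport i j → P i j → Q i j) : 𝒰 P ≤ 𝒰 Q :=
  H.bigradedSum_le fun i j hs hp => inf_le_bigradedSum (h i j hs hp)

theorem lie_mem (H : StarGrading gr1 gr2 χ aa) {x y : L} (hx : x ∈ 𝒰 P) (hy : y ∈ 𝒰 Q)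
    (h : ∀ i j k l, StarSupport i j → StarSupport k l → StarSupport (i + k) (j + l) →
      P i j → Q k l → R (i + k) (j + l)) : ⁅x, y⁆ ∈ 𝒰 R := by
  have h1 : 𝒰 Q ≤ (𝒰 R).comap (LieAlgebra.ad ℂ L x : L →ₗ[ℂ] L) := by
    refine H.bigradedSum_le fun k l hkl hq z hz => ?_
    have h2 : 𝒰 P ≤ (𝒰 R).comap (LieAlgebra.ad ℂ L z : L →ₗ[ℂ] L) := by
      refine H.bigradedSum_le fun i j hij hp w hw => ?_
      change ⁅z, w⁆ ∈ 𝒰 R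
      rw [← lie_skew]
      refine neg_mem ?_
      by_cases h0 : ⁅w, z⁆ = 0
      · simp [h0]
      have m1 := H.lie_mem₁ i k w hw.1 z hz.1
      have m2 := H.lie_mem₂ j l w hw.2 z hz.2
      exact inf_le_bigradedSum (h i j k l hij hkl (H.starSupport _ _ _ m1 m2 h0) hp hq) ⟨m1, m2⟩
    have h3 : ⁅z, x⁆ ∈ 𝒰 R := h2 hx
    change ⁅x, z⁆ ∈ 𝒰 R
    rw [← lie_skew]
    exact neg_mem h3
  exact h1 hy

theorem χ_apply_eq_zero (H : StarGrading gr1 gr2 χ aa) {x : L} (hx : x ∈ 𝒰 P)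
    (h : ∀ i j, StarSupport i j → P i j → ¬((i = 0 ∨ i = 2) ∧ j = 2)) : χ x = 0 :=
  (H.bigradedSum_le (M := LinearMap.ker χ) fun i j hs hp z hz =>
    H.χ_eq_zero i j z hz.1 hz.2 (h i j hs hp)) hx

theorem χ_lie_eq_zero (H : StarGrading gr1 gr2 χ aa) {x y : L} (hx : x ∈ 𝒰 P) (hy : y ∈ 𝒰 Q)
    (h : ∀ i j k l, StarSupport i j → StarSupport k l → StarSupport (i + k) (j + l) →
      P i j → Q k l → ¬((i + k = 0 ∨ i + k = 2) ∧ j + l = 2)) : χ ⁅x, y⁆ = 0 :=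
  H.χ_apply_eq_zero (P := fun i j => ¬((i = 0 ∨ i = 2) ∧ j = 2)) (H.lie_mem hx hy h)
    fun _ _ _ h => h

theorem bigradedSum_eq_le (H : StarGrading gr1 gr2 χ aa) (m n : ℤ) :
    𝒰 (fun i j => i = m ∧ j = n) ≤ gr1 m ⊓ gr2 n :=
  H.bigradedSum_le fun i j _ h => by rw [h.1, h.2]

theorem χ_ad_pow_eq_zero (H : StarGrading gr1 gr2 χ aa) {v x : L} (hv : v ∈ 𝒰 P)
    (hx : x ∈ 𝒰 Q)
    (h : ∀ i j k l, StarSupport i j → StarSupport k l → StarSupport (i + k) (j + l) →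
      P i j → Q k l → Q (i + k) (j + l))
    (h0 : ∀ i j, StarSupport i j → Q i j → ¬((i = 0 ∨ i = 2) ∧ j = 2)) (k : ℕ) :
    χ (((LieAlgebra.ad ℂ L v : Module.End ℂ L) ^ k) x) = 0 := by
  induction k generalizing x with
  | zero => exact H.χ_apply_eq_zero hx h0
  | succ k ih => exact ih (H.lie_mem hv hx h)

theorem ad_pow_succ_apply (v x : L) (k : ℕ) :
    ((LieAlgebra.ad ℂ L v : Module.End ℂ L) ^ (k + 1)) x =
      ((LieAlgebra.ad ℂ L v : Module.End ℂ L) ^ k) ⁅v, x⁆ := rfl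

/-- An element of `ñ₂` split into its components in `g_{1,0}`, `aa`, `g_{1,1}`, `g_{2,1}` and the
part of degree at least `2` for the second grading. -/
structure Split (gr1 gr2 : ℤ → Submodule ℂ L) (aa : Submodule ℂ L) (s a u b r : L) : Prop where
  s : s ∈ bigradedSum gr1 gr2 fun i j => i = 1 ∧ j = 0
  a_aa : a ∈ aa
  a : a ∈ bigradedSum gr1 gr2 fun i j => i = 0 ∧ j = 1
  u : u ∈ bigradedSum gr1 gr2 fun i j => i = 1 ∧ j = 1
  b : b ∈ bigradedSum gr1 gr2 fun i j => i = 2 ∧ j = 1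
  r : r ∈ bigradedSum gr1 gr2 fun _ j => 2 ≤ j

variable {s a u b r x : L}

theorem aa_le_bigradedSum (H : StarGrading gr1 gr2 χ aa) (hP : P 0 1) : aa ≤ 𝒰 P :=
  H.aa_le.trans (inf_le_bigradedSum hP)

local notation "τ" => fun (k : ℕ) (x : L) =>
  χ (((LieAlgebra.ad ℂ L (s + (a + u + b + r)) : Module.End ℂ L) ^ k) x)

theorem mem_of_split (H : StarGrading gr1 gr2 χ aa) (V : Split gr1 gr2 aa s a u b r) :
    s + (a + u + b + r) ∈ 𝒰 fun i j => 0 ≤ i ∧ 0 ≤ j ∧ (1 ≤ i ∨ 1 ≤ j) := by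
  have h1 := H.bigradedSum_mono (Q := fun i j => 0 ≤ i ∧ 0 ≤ j ∧ (1 ≤ i ∨ 1 ≤ j))
    (fun i j hs hp => by simp only [StarSupport] at *; omega) V.s
  have h2 := H.bigradedSum_mono (Q := fun i j => 0 ≤ i ∧ 0 ≤ j ∧ (1 ≤ i ∨ 1 ≤ j))
    (fun i j hs hp => by simp only [StarSupport] at *; omega) V.a
  have h3 := H.bigradedSum_mono (Q := fun i j => 0 ≤ i ∧ 0 ≤ j ∧ (1 ≤ i ∨ 1 ≤ j))
    (fun i j hs hp => by simp only [StarSupport] at *; omega) V.u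
  have h4 := H.bigradedSum_mono (Q := fun i j => 0 ≤ i ∧ 0 ≤ j ∧ (1 ≤ i ∨ 1 ≤ j))
    (fun i j hs hp => by simp only [StarSupport] at *; omega) V.b
  have h5 := H.bigradedSum_mono (Q := fun i j => 0 ≤ i ∧ 0 ≤ j ∧ (1 ≤ i ∨ 1 ≤ j))
    (fun i j hs hp => by simp only [StarSupport] at *; omega) V.r
  exact add_mem h1 (add_mem (add_mem (add_mem h2 h3) h4) h5)

theorem tau_high (H : StarGrading gr1 gr2 χ aa) (V : Split gr1 gr2 aa s a u b r)
    (hx : x ∈ 𝒰 fun i j => 2 ≤ j ∧ (3 ≤ i ∨ 3 ≤ j)) (k : ℕ) : τ k x = 0 :=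
  H.χ_ad_pow_eq_zero (H.mem_of_split V) hx (fun i j k l _ _ _ h1 h2 => by omega)
    (fun i j _ h => by omega) k

/-- On the part of degree at least `2` for the second grading only `s` contributes. -/
theorem tau_two (H : StarGrading gr1 gr2 χ aa) (V : Split gr1 gr2 aa s a u b r)
    (hx : x ∈ 𝒰 fun _ j => 2 ≤ j) (k : ℕ) :
    τ k x = χ (((LieAlgebra.ad ℂ L s : Module.End ℂ L) ^ k) x) := by
  induction k generalizing x with
  | zero => rfl
  | succ k ih =>
    have hq : ⁅a + u + b + r, x⁆ ∈ 𝒰 fun i j => 2 ≤ j ∧ (3 ≤ i ∨ 3 ≤ j) := by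
      simp only [add_lie]
      refine add_mem (add_mem (add_mem (H.lie_mem V.a hx ?_) (H.lie_mem V.u hx ?_))
        (H.lie_mem V.b hx ?_)) (H.lie_mem V.r hx ?_) <;>
      · intros; omega
    have hs : ⁅s, x⁆ ∈ 𝒰 fun _ j => 2 ≤ j := H.lie_mem V.s hx (by intros; omega)
    have := H.tau_high V hq k
    have h2 := ih hs
    change χ (((LieAlgebra.ad ℂ L (s + (a + u + b + r)) : Module.End ℂ L) ^ k)
      ⁅s + (a + u + b + r), x⁆) = _
    rw [add_lie s, LinearMap.map_add, LinearMap.map_add]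
    exact (congrArg₂ (· + ·) h2 this).trans (add_zero _)

theorem tau_two_eq_zero (H : StarGrading gr1 gr2 χ aa) (V : Split gr1 gr2 aa s a u b r) (m : ℕ)
    (hx : x ∈ 𝒰 fun i j => 2 ≤ j ∧ 3 - m ≤ i) (k : ℕ) (hk : m ≤ k) : τ k x = 0 := by
  have h2 : x ∈ 𝒰 fun _ j => 2 ≤ j := H.bigradedSum_mono (fun i j _ h => h.1) hx
  refine (H.tau_two V h2 k).trans ?_
  clear h2
  induction k generalizing m x with
  | zero => exact H.χ_apply_eq_zero hx (fun i j _ h => by omega)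
  | succ k ih =>
    rw [ad_pow_succ_apply]
    exact ih (m - 1) (H.lie_mem V.s hx (by intros; omega)) (by omega)

theorem tau_zero (x : L) : τ 0 x = χ x := rfl

theorem tau_succ (k : ℕ) : τ (k + 1) x = τ k ⁅s, x⁆ + (τ k ⁅a, x⁆ + τ k ⁅u, x⁆ + τ k ⁅b, x⁆
    + τ k ⁅r, x⁆) := by
  change χ (((LieAlgebra.ad ℂ L (s + (a + u + b + r)) : Module.End ℂ L) ^ k)
    ⁅s + (a + u + b + r), x⁆) = _
  simp only [add_lie, map_add]

theorem tau_g21 (H : StarGrading gr1 gr2 χ aa) (V : Split gr1 gr2 aa s a u b r)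
    (hx : x ∈ 𝒰 fun i j => i = 2 ∧ j = 1) (k : ℕ) : τ k x = 0 := by
  cases k with
  | zero => exact H.χ_apply_eq_zero hx (by intros; omega)
  | succ k =>
    have hs := H.tau_high V (H.lie_mem V.s hx (by simp only [StarSupport]; intros; omega)) k
    have hu := H.tau_high V (H.lie_mem V.u hx (by intros; omega)) k
    have hb := H.tau_high V (H.lie_mem V.b hx (by intros; omega)) k
    have hr := H.tau_high V (H.lie_mem V.r hx (by intros; omega)) k
    have ha : τ k ⁅a, x⁆ = 0 := by
      cases k with
      | zero => exact H.χ_lie_aa a V.a_aa x (H.bigradedSum_eq_le 2 1 hx)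
      | succ k => exact H.tau_two_eq_zero V 1 (H.lie_mem V.a hx (by intros; omega)) _ (by omega)
    rw [tau_succ, hs, ha, hu, hb, hr]
    simp

theorem tau_g11 (H : StarGrading gr1 gr2 χ aa) (V : Split gr1 gr2 aa s a u b r)
    (hx : x ∈ 𝒰 fun i j => i = 1 ∧ j = 1) (k : ℕ) :
    τ (k + 1) x = τ k ⁅a, x⁆ + τ k ⁅u, x⁆ := by
  have hs := H.tau_g21 V (H.lie_mem V.s hx (by intros; omega)) k
  have hb := H.tau_high V (H.lie_mem V.b hx (by intros; omega)) k
  have hr := H.tau_high V (H.lie_mem V.r hx (by intros; omega)) k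
  rw [tau_succ, hs, hb, hr]
  simp

theorem tau_g11_zero (H : StarGrading gr1 gr2 χ aa)
    (hx : x ∈ 𝒰 fun i j => i = 1 ∧ j = 1) : τ 0 x = 0 :=
  H.χ_apply_eq_zero hx (by intros; omega)

theorem tau_g11_one (H : StarGrading gr1 gr2 χ aa) (V : Split gr1 gr2 aa s a u b r)
    (hx : x ∈ 𝒰 fun i j => i = 1 ∧ j = 1) : τ 1 x = χ ⁅u, x⁆ := by
  have ha : τ 0 ⁅a, x⁆ = 0 := H.χ_lie_eq_zero V.a hx (by intros; omega)
  rw [H.tau_g11 V hx 0, ha, zero_add]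
  rfl

theorem χ_lie_s_lie_a (H : StarGrading gr1 gr2 χ aa) (V : Split gr1 gr2 aa s a u b r)
    (hx : x ∈ 𝒰 fun i j => i = 1 ∧ j = 1) : χ ⁅s, ⁅a, x⁆⁆ = χ ⁅⁅s, a⁆, x⁆ := by
  have h : χ ⁅a, ⁅s, x⁆⁆ = 0 := H.χ_lie_aa a V.a_aa _
    (H.bigradedSum_eq_le 2 1 (H.lie_mem V.s hx (by intros; omega)))
  rw [leibniz_lie s a x, map_add, h, add_zero]

theorem tau_g11_two (H : StarGrading gr1 gr2 χ aa) (V : Split gr1 gr2 aa s a u b r)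
    (hx : x ∈ 𝒰 fun i j => i = 1 ∧ j = 1) : τ 2 x = χ ⁅⁅s, a⁆, x⁆ := by
  have hu := H.tau_two_eq_zero V 1 (H.lie_mem V.u hx (by intros; omega)) 1 (by omega)
  have ha := H.tau_two V (H.lie_mem V.a hx (by intros; omega)) 1
  rw [H.tau_g11 V hx 1, hu, ha, add_zero, pow_one, LieAlgebra.ad_apply, H.χ_lie_s_lie_a V hx]

theorem tau_g11_ge (H : StarGrading gr1 gr2 χ aa) (V : Split gr1 gr2 aa s a u b r)
    (hx : x ∈ 𝒰 fun i j => i = 1 ∧ j = 1) (k : ℕ) (hk : 3 ≤ k) : τ k x = 0 := by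
  obtain ⟨k, rfl⟩ : ∃ l, k = l + 1 := ⟨k - 1, by omega⟩
  have hu := H.tau_two_eq_zero V 2 (H.lie_mem V.u hx (by intros; omega)) k (by omega)
  have ha := H.tau_two_eq_zero V 2 (H.lie_mem V.a hx (by intros; omega)) k (by omega)
  rw [H.tau_g11 V hx, hu, ha, add_zero]

theorem tau_aa (H : StarGrading gr1 gr2 χ aa) (V : Split gr1 gr2 aa s a u b r)
    (hx : x ∈ 𝒰 fun i j => i = 0 ∧ j = 1) (k : ℕ) :
    τ (k + 1) x = τ k ⁅s, x⁆ + (τ k ⁅a, x⁆ + τ k ⁅u, x⁆ + τ k ⁅b, x⁆) := by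
  have hr := H.tau_high V (H.lie_mem V.r hx (by intros; omega)) k
  rw [tau_succ, hr, add_zero]

theorem χ_lie_g21_aa (H : StarGrading gr1 gr2 χ aa) {y : L} (hx : x ∈ aa)
    (hy : y ∈ 𝒰 fun i j => i = 2 ∧ j = 1) : χ ⁅y, x⁆ = 0 := by
  rw [← lie_skew, map_neg, H.χ_lie_aa x hx y (H.bigradedSum_eq_le 2 1 hy), neg_zero]

theorem tau_aa_one (H : StarGrading gr1 gr2 χ aa) (V : Split gr1 gr2 aa s a u b r)
    (hx : x ∈ aa) : τ 1 x = 0 := by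
  have hx' := H.aa_le_bigradedSum (P := fun i j => i = 0 ∧ j = 1) ⟨rfl, rfl⟩ hx
  have hs : τ 0 ⁅s, x⁆ = 0 := H.tau_g11_zero (H.lie_mem V.s hx' (by intros; omega))
  have ha : τ 0 ⁅a, x⁆ = 0 := H.χ_lie_aa_aa a V.a_aa x hx
  have hu : τ 0 ⁅u, x⁆ = 0 := H.χ_lie_eq_zero V.u hx' (by intros; omega)
  have hb : τ 0 ⁅b, x⁆ = 0 := H.χ_lie_g21_aa hx V.b
  rw [H.tau_aa V hx' 0, hs, ha, hu, hb]
  simp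

theorem χ_lie_lie_comm (H : StarGrading gr1 gr2 χ aa) {s u : L}
    (hs : s ∈ 𝒰 fun i j => i = 1 ∧ j = 0) (hu : u ∈ 𝒰 fun i j => i = 1 ∧ j = 1)
    (hx : x ∈ aa) : χ ⁅s, ⁅u, x⁆⁆ = χ ⁅u, ⁅s, x⁆⁆ := by
  rw [leibniz_lie s u x, map_add, H.χ_lie_g21_aa hx (H.lie_mem hs hu (by intros; omega)), zero_add]

theorem tau_aa_two (H : StarGrading gr1 gr2 χ aa) (V : Split gr1 gr2 aa s a u b r)
    (hx : x ∈ aa) : τ 2 x = 2 * χ ⁅u, ⁅s, x⁆⁆ := by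
  have hx' := H.aa_le_bigradedSum (P := fun i j => i = 0 ∧ j = 1) ⟨rfl, rfl⟩ hx
  have hs := H.tau_g11_one V (H.lie_mem V.s hx' (by intros; omega))
  have hax := H.lie_mem (R := fun i j => i = 0 ∧ j = 2) V.a hx' (by intros; omega)
  have ha := H.tau_two V (H.lie_mem V.a hx' (by intros; omega)) 1
  have ha' : χ ⁅s, ⁅a, x⁆⁆ = 0 := H.χ_lie_eq_zero V.s hax (by intros; omega)
  have hu := H.tau_two V (H.lie_mem V.u hx' (by intros; omega)) 1
  have hb := H.tau_two_eq_zero V 1 (H.lie_mem V.b hx' (by intros; omega)) 1 (by omega)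
  rw [H.tau_aa V hx' 1, hs, ha, hu, hb, pow_one, LieAlgebra.ad_apply, LieAlgebra.ad_apply, ha',
    H.χ_lie_lie_comm V.s V.u hx]
  ring

theorem tau_aa_three (H : StarGrading gr1 gr2 χ aa) (V : Split gr1 gr2 aa s a u b r)
    (hx : x ∈ aa) : τ 3 x = 3 * χ ⁅⁅s, a⁆, ⁅s, x⁆⁆ := by
  have hx' := H.aa_le_bigradedSum (P := fun i j => i = 0 ∧ j = 1) ⟨rfl, rfl⟩ hx
  have hs := H.tau_g11_two V (H.lie_mem V.s hx' (by intros; omega))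
  have ha := H.tau_two V (H.lie_mem V.a hx' (by intros; omega)) 2
  have hu := H.tau_two_eq_zero V 2 (H.lie_mem V.u hx' (by intros; omega)) 2 (by omega)
  have hb := H.tau_two_eq_zero V 2 (H.lie_mem V.b hx' (by intros; omega)) 2 (by omega)
  have hsx := H.lie_mem (R := fun i j => i = 1 ∧ j = 1) V.s hx' (by intros; omega)
  have hsa := H.lie_mem (R := fun i j => i = 1 ∧ j = 1) V.s V.a (by intros; omega)
  have h1 : χ ⁅⁅s, ⁅s, a⁆⁆, x⁆ = 0 :=
    H.χ_lie_g21_aa hx (H.lie_mem V.s hsa (by intros; omega))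
  have h2 : χ ⁅a, ⁅s, ⁅s, x⁆⁆⁆ = 0 := H.χ_lie_aa a V.a_aa _
    (H.bigradedSum_eq_le 2 1 (H.lie_mem V.s hsx (by intros; omega)))
  have h3 : ((LieAlgebra.ad ℂ L s : Module.End ℂ L) ^ 2) ⁅a, x⁆ = ⁅s, ⁅s, ⁅a, x⁆⁆⁆ := rfl
  rw [H.tau_aa V hx' 2, hs, ha, hu, hb, h3, leibniz_lie s a x, lie_add, leibniz_lie s ⁅s, a⁆ x,
    leibniz_lie s a ⁅s, x⁆]
  simp only [map_add, h1, h2]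
  ring

theorem tau_aa_ge (H : StarGrading gr1 gr2 χ aa) (V : Split gr1 gr2 aa s a u b r)
    (hx : x ∈ aa) (k : ℕ) (hk : 4 ≤ k) : τ k x = 0 := by
  obtain ⟨k, rfl⟩ : ∃ l, k = l + 1 := ⟨k - 1, by omega⟩
  have hx' := H.aa_le_bigradedSum (P := fun i j => i = 0 ∧ j = 1) ⟨rfl, rfl⟩ hx
  have hs := H.tau_g11_ge V (H.lie_mem V.s hx' (by intros; omega)) k (by omega)
  have ha := H.tau_two_eq_zero V 3 (H.lie_mem V.a hx' (by intros; omega)) k (by omega)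
  have hu := H.tau_two_eq_zero V 3 (H.lie_mem V.u hx' (by intros; omega)) k (by omega)
  have hb := H.tau_two_eq_zero V 3 (H.lie_mem V.b hx' (by intros; omega)) k (by omega)
  rw [H.tau_aa V hx', hs, ha, hu, hb]
  simp

variable {n : ℕ}

theorem coadExp_two (H : StarGrading gr1 gr2 χ aa) (V : Split gr1 gr2 aa s a u b r)
    (hn : (LieAlgebra.ad ℂ L (s + (a + u + b + r)) : Module.End ℂ L) ^ n = 0)
    (hx : x ∈ 𝒰 fun _ j => 2 ≤ j) :
    coadExp χ n (s + (a + u + b + r)) x = χ x - χ ⁅s, x⁆ + 2⁻¹ * χ ⁅s, ⁅s, x⁆⁆ := by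
  have h3 : x ∈ 𝒰 fun i j => 2 ≤ j ∧ 3 - (3 : ℕ) ≤ i :=
    H.bigradedSum_mono (by simp only [StarSupport]; intros; omega) hx
  rw [coadExp_apply_eq_sum hn 3 (H.tau_two_eq_zero V 3 h3)]
  have h1 := H.tau_two V hx 1
  have h2 := H.tau_two V hx 2
  have e1 : ((LieAlgebra.ad ℂ L s : Module.End ℂ L) ^ 1) x = ⁅s, x⁆ := rfl
  have e2 : ((LieAlgebra.ad ℂ L s : Module.End ℂ L) ^ 2) x = ⁅s, ⁅s, x⁆⁆ := rfl
  have h0 := tau_zero (χ := χ) (s := s) (a := a) (u := u) (b := b) (r := r) x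
  beta_reduce at h0 h1 h2
  simp only [Finset.sum_range_succ, Finset.sum_range_zero, h0, h1, h2, e1, e2]
  norm_num [Nat.factorial]
  ring

theorem coadExp_g21 (H : StarGrading gr1 gr2 χ aa) (V : Split gr1 gr2 aa s a u b r)
    (hn : (LieAlgebra.ad ℂ L (s + (a + u + b + r)) : Module.End ℂ L) ^ n = 0)
    (hx : x ∈ 𝒰 fun i j => i = 2 ∧ j = 1) :
    coadExp χ n (s + (a + u + b + r)) x = 0 := by
  rw [coadExp_apply_eq_sum hn 0 fun k _ => H.tau_g21 V hx k]
  simp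

theorem coadExp_g11 (H : StarGrading gr1 gr2 χ aa) (V : Split gr1 gr2 aa s a u b r)
    (hn : (LieAlgebra.ad ℂ L (s + (a + u + b + r)) : Module.End ℂ L) ^ n = 0)
    (hx : x ∈ 𝒰 fun i j => i = 1 ∧ j = 1) :
    coadExp χ n (s + (a + u + b + r)) x = - χ ⁅u - (2⁻¹ : ℂ) • ⁅s, a⁆, x⁆ := by
  rw [coadExp_apply_eq_sum hn 3 (H.tau_g11_ge V hx)]
  have h0 : τ 0 x = 0 := H.tau_g11_zero hx
  have h1 := H.tau_g11_one V hx
  have h2 := H.tau_g11_two V hx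
  beta_reduce at h0 h1 h2
  simp only [Finset.sum_range_succ, Finset.sum_range_zero, h0, h1, h2, sub_lie, smul_lie, map_sub,
    map_smul, smul_eq_mul]
  norm_num [Nat.factorial]
  ring

theorem coadExp_aa (H : StarGrading gr1 gr2 χ aa) (V : Split gr1 gr2 aa s a u b r)
    (hn : (LieAlgebra.ad ℂ L (s + (a + u + b + r)) : Module.End ℂ L) ^ n = 0) (hx : x ∈ aa) :
    coadExp χ n (s + (a + u + b + r)) x = χ ⁅u - (2⁻¹ : ℂ) • ⁅s, a⁆, ⁅s, x⁆⁆ := by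
  rw [coadExp_apply_eq_sum hn 4 (H.tau_aa_ge V hx)]
  have hx' := H.aa_le_bigradedSum (P := fun i j => i = 0 ∧ j = 1) ⟨rfl, rfl⟩ hx
  have h0 : τ 0 x = 0 := H.χ_apply_eq_zero hx' (by intros; omega)
  have h1 := H.tau_aa_one V hx
  have h2 := H.tau_aa_two V hx
  have h3 := H.tau_aa_three V hx
  beta_reduce at h0 h1 h2 h3
  simp only [Finset.sum_range_succ, Finset.sum_range_zero, h0, h1, h2, h3, sub_lie, smul_lie,
    map_sub, map_smul, smul_eq_mul]
  norm_num [Nat.factorial]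
  ring

/-- The linear form `-χ - χ ∘ ad v - χ ∘ ad w - ½ χ ∘ (ad (v + w))²`. -/
noncomputable def quadraticForm (χ : Module.Dual ℂ L) (v w : L) : Module.Dual ℂ L :=
  -χ - χ ∘ₗ (LieAlgebra.ad ℂ L v : L →ₗ[ℂ] L) - χ ∘ₗ (LieAlgebra.ad ℂ L w : L →ₗ[ℂ] L)
    - (2⁻¹ : ℂ) • (χ ∘ₗ (((LieAlgebra.ad ℂ L (v + w) : Module.End ℂ L) ^ 2) : L →ₗ[ℂ] L))

theorem quadraticForm_apply (v w x : L) : quadraticForm χ v w x =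
    -χ x - χ ⁅v, x⁆ - χ ⁅w, x⁆ - 2⁻¹ * χ ⁅v + w, ⁅v + w, x⁆⁆ := by
  rfl

theorem quadraticForm_apply' (v w x : L) : quadraticForm χ v w x =
    -χ x - χ ⁅v, x⁆ - χ ⁅w, x⁆ - 2⁻¹ * (χ ⁅v, ⁅v, x⁆⁆ + χ ⁅v, ⁅w, x⁆⁆ + χ ⁅w, ⁅v, x⁆⁆
      + χ ⁅w, ⁅w, x⁆⁆) := by
  rw [quadraticForm_apply]
  simp only [add_lie, lie_add, map_add]
  ring

/-- On `n₂`, each point of `-Ad*(Ñ₂)χ` agrees with a quadratic expression. -/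
theorem neg_coadExp_sub_quadraticForm_mem (H : StarGrading gr1 gr2 χ aa)
    (V : Split gr1 gr2 aa s a u b r)
    (hn : (LieAlgebra.ad ℂ L (s + (a + u + b + r)) : Module.End ℂ L) ^ n = 0) :
    -coadExp χ n (s + (a + u + b + r)) - quadraticForm χ (-s) (-(u - (2⁻¹ : ℂ) • ⁅s, a⁆)) ∈
      ((aa ⊔ (𝒰 fun i j => i = 1 ∧ j = 1) ⊔ (𝒰 fun i j => i = 2 ∧ j = 1))
        ⊔ 𝒰 fun _ j => 2 ≤ j).dualAnnihilator := by
  have hm : u - (2⁻¹ : ℂ) • ⁅s, a⁆ ∈ 𝒰 fun i j => i = 1 ∧ j = 1 :=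
    sub_mem V.u (Submodule.smul_mem _ _ (H.lie_mem V.s V.a (by intros; omega)))
  have h_aa := fun x => H.coadExp_aa (x := x) V hn
  have h11 := fun x => H.coadExp_g11 (x := x) V hn
  generalize u - (2⁻¹ : ℂ) • ⁅s, a⁆ = m at *
  simp only [Submodule.dualAnnihilator_sup_eq, Submodule.mem_inf, Submodule.mem_dualAnnihilator,
    LinearMap.sub_apply, LinearMap.neg_apply, quadraticForm_apply', neg_lie, lie_neg, map_neg,
    neg_neg]
  refine ⟨⟨⟨fun x hx => ?_, fun x hx => ?_⟩, fun x hx => ?_⟩, fun x hx => ?_⟩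
  · have hx' := H.aa_le_bigradedSum (P := fun i j => i = 0 ∧ j = 1) ⟨rfl, rfl⟩ hx
    have hsx := H.lie_mem (R := fun i j => i = 1 ∧ j = 1) V.s hx' (by intros; omega)
    have hmx := H.lie_mem (R := fun i j => i = 1 ∧ j = 2) hm hx' (by intros; omega)
    rw [h_aa x hx, H.χ_apply_eq_zero hx' (by intros; omega),
      H.χ_apply_eq_zero hsx (by intros; omega), H.χ_apply_eq_zero hmx (by intros; omega),
      H.χ_lie_eq_zero V.s hsx (by intros; omega), H.χ_lie_eq_zero hm hmx (by intros; omega),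
      H.χ_lie_lie_comm V.s hm hx]
    ring
  · have hsx := H.lie_mem (R := fun i j => i = 2 ∧ j = 1) V.s hx (by intros; omega)
    have hmx := H.lie_mem (R := fun i j => i = 2 ∧ j = 2) hm hx (by intros; omega)
    rw [h11 x hx, H.χ_apply_eq_zero hx (by intros; omega),
      H.χ_apply_eq_zero hsx (by intros; omega),
      H.χ_lie_eq_zero V.s hsx (by intros; omega), H.χ_lie_eq_zero hm hmx (by intros; omega),
      H.χ_lie_eq_zero V.s hmx (by intros; omega), H.χ_lie_eq_zero hm hsx (by intros; omega)]
    ring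
  · have hsx := H.lie_mem (R := fun i j => i = 3 ∧ j = 1) V.s hx (by intros; omega)
    have hmx := H.lie_mem (R := fun i j => i = 3 ∧ j = 2) hm hx (by intros; omega)
    rw [H.coadExp_g21 V hn hx, H.χ_apply_eq_zero hx (by intros; omega),
      H.χ_apply_eq_zero hsx (by intros; omega), H.χ_apply_eq_zero hmx (by intros; omega),
      H.χ_lie_eq_zero V.s hsx (by intros; omega), H.χ_lie_eq_zero hm hmx (by intros; omega),
      H.χ_lie_eq_zero V.s hmx (by intros; omega), H.χ_lie_eq_zero hm hsx (by intros; omega)]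
    ring
  · have hsx := H.lie_mem (R := fun i j => 2 ≤ j) V.s hx (by intros; omega)
    have hmx := H.lie_mem (R := fun i j => 3 ≤ j) hm hx (by intros; omega)
    rw [H.coadExp_two V hn hx, H.χ_apply_eq_zero hmx (by intros; omega),
      H.χ_lie_eq_zero hm hmx (by intros; omega),
      H.χ_lie_eq_zero V.s hmx (by intros; omega), H.χ_lie_eq_zero hm hsx (by intros; omega)]
    ring

theorem χ_ad_pow_eq_zero_of_le (H : StarGrading gr1 gr2 χ aa) {v : L}
    (hv : v ∈ 𝒰 fun i _ => i = 1) (hx : x ∈ 𝒰 fun i _ => 0 ≤ i) (k : ℕ) (hk : 3 ≤ k) :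
    χ (((LieAlgebra.ad ℂ L v : Module.End ℂ L) ^ k) x) = 0 := by
  obtain ⟨k, rfl⟩ : ∃ l, k = l + 3 := ⟨k - 3, by omega⟩
  have h1 := H.lie_mem (R := fun i _ => 1 ≤ i) hv hx (by intros; omega)
  have h2 := H.lie_mem (R := fun i _ => 2 ≤ i) hv h1 (by intros; omega)
  have h3 := H.lie_mem (R := fun i _ => 3 ≤ i) hv h2 (by intros; omega)
  exact H.χ_ad_pow_eq_zero hv h3 (by intros; omega) (by intros; omega) k

/-- The exponential series along `g_{1,0} + g_{1,1} + g_{1,2}` stops at the quadratic term. -/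
theorem neg_coadExp_neg_apply (H : StarGrading gr1 gr2 χ aa) {v w c : L}
    (hv : v ∈ 𝒰 fun i j => i = 1 ∧ j = 0) (hw : w ∈ 𝒰 fun i j => i = 1 ∧ j = 1)
    (hc : c ∈ 𝒰 fun i j => i = 1 ∧ j = 2)
    (hn : (LieAlgebra.ad ℂ L (-(v + w + c)) : Module.End ℂ L) ^ n = 0)
    (hx : x ∈ 𝒰 fun i j => 0 ≤ i ∧ 0 ≤ j ∧ (1 ≤ i ∨ 1 ≤ j)) :
    -coadExp χ n (-(v + w + c)) x = quadraticForm χ v w x - χ ⁅c, x⁆ := by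
  have hz : v + w ∈ 𝒰 fun i j => i = 1 ∧ 0 ≤ j :=
    add_mem (H.bigradedSum_mono (by intros; omega) hv) (H.bigradedSum_mono (by intros; omega) hw)
  have hy : -(v + w + c) ∈ 𝒰 fun i _ => i = 1 :=
    neg_mem (add_mem (H.bigradedSum_mono (fun _ _ _ h => h.1) hz)
      (H.bigradedSum_mono (fun _ _ _ h => h.1) hc))
  rw [coadExp_apply_eq_sum hn 3 (H.χ_ad_pow_eq_zero_of_le hy
    (H.bigradedSum_mono (fun _ _ _ h => h.1) hx))]
  have hcx := H.lie_mem (R := fun i j => 1 ≤ i ∧ 2 ≤ j ∧ (2 ≤ i ∨ 3 ≤ j)) hc hx (by intros; omega)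
  have hzx := H.lie_mem (R := fun i j => 1 ≤ i ∧ 0 ≤ j ∧ (2 ≤ i ∨ 1 ≤ j)) hz hx (by intros; omega)
  have z1 := H.χ_lie_eq_zero hz hcx (by intros; omega)
  have z2 := H.χ_lie_eq_zero hc hcx (by intros; omega)
  have z3 := H.χ_lie_eq_zero hc hzx (by intros; omega)
  have e0 : ((LieAlgebra.ad ℂ L (-(v + w + c)) : Module.End ℂ L) ^ 0) x = x := rfl
  have e1 : ((LieAlgebra.ad ℂ L (-(v + w + c)) : Module.End ℂ L) ^ 1) x = ⁅-(v + w + c), x⁆ := rfl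
  have e2 : ((LieAlgebra.ad ℂ L (-(v + w + c)) : Module.End ℂ L) ^ 2) x =
    ⁅-(v + w + c), ⁅-(v + w + c), x⁆⁆ := rfl
  simp only [Finset.sum_range_succ, Finset.sum_range_zero, e0, e1, e2, quadraticForm_apply]
  have f1 : χ ⁅v + w, x⁆ = χ ⁅v, x⁆ + χ ⁅w, x⁆ := by rw [add_lie, map_add]
  generalize v + w = z at *
  simp only [neg_lie, lie_neg, add_lie, lie_add, map_add, map_neg, z1, z2, z3, f1]
  norm_num [Nat.factorial]
  ring

end StarGrading

/-- Under the conditions (★), with `π₂ : g* → n₂*` and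
`π̃₂ : g* → ñ₂*` the restriction maps, `O₂⁻ = Ad*(N₂)·(-χ̄₂)` and
`Õ₂⁻ = Ad*(Ñ₂)·(-χ̃₂)`: the fiber inclusion `π₂⁻¹(O₂⁻) ⊆ π̃₂⁻¹(Õ₂⁻)` holds.
Explicitly, `n₂^⊥ = ñ₂^⊥ ⊕ ad*(g_{1,2})χ₂`,
`π₂⁻¹(O₂⁻) = -χ₂ + ad*(g_{1,1})χ₂ ⊕ n₂^⊥`, and
`π̃₂⁻¹(Õ₂⁻) = {-χ₂ - ad*(v)χ₂ - ad*(w)χ₂ - ½ ad*(v+w)²χ₂ : v ∈ g_{1,0}, w ∈ g_{1,1}}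
⊕ n₂^⊥`.  As before `ad*(v)χ = -χ ∘ ad v`, `ad*(v)²χ = χ ∘ (ad v)²`, and the orbits of
the unipotent groups are realized through exponentials of the coadjoint action. -/
theorem statement15
    (g : Type*) [LieRing g] [LieAlgebra ℂ g] [FiniteDimensional ℂ g]
    [LieAlgebra.IsSimple ℂ g]
    (Φ : g →ₗ[ℂ] g →ₗ[ℂ] ℂ)
    (hsymm : ∀ x y : g, Φ x y = Φ y x)
    (hinv : ∀ x y z : g, Φ ⁅x, y⁆ z = Φ x ⁅y, z⁆)
    (hnondeg : ∀ x : g, (∀ y : g, Φ x y = 0) → x = 0)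
    (gr1 gr2 : ℤ → Submodule ℂ g)
    (hdec1 : DirectSum.IsInternal fun δ : ℤ => gr1 δ)
    (hdec2 : DirectSum.IsInternal fun δ : ℤ => gr2 δ)
    (hbidec : DirectSum.IsInternal fun p : ℤ × ℤ => gr1 p.1 ⊓ gr2 p.2)
    (hbr1 : ∀ δ₁ δ₂ : ℤ, ∀ x ∈ gr1 δ₁, ∀ y ∈ gr1 δ₂, ⁅x, y⁆ ∈ gr1 (δ₁ + δ₂))
    (hbr2 : ∀ δ₁ δ₂ : ℤ, ∀ x ∈ gr2 δ₁, ∀ y ∈ gr2 δ₂, ⁅x, y⁆ ∈ gr2 (δ₁ + δ₂))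
    (f1 f2 : g) (hf1 : f1 ∈ gr1 (-2)) (hf2 : f2 ∈ gr2 (-2))
    (hgood1inj : ∀ δ : ℤ, 1 ≤ δ → ∀ x ∈ gr1 δ, ⁅f1, x⁆ = 0 → x = 0)
    (hgood1surj : ∀ δ : ℤ, δ ≤ 1 → ∀ y ∈ gr1 (δ - 2), ∃ x ∈ gr1 δ, ⁅f1, x⁆ = y)
    (hgood2inj : ∀ δ : ℤ, 1 ≤ δ → ∀ x ∈ gr2 δ, ⁅f2, x⁆ = 0 → x = 0)
    (hgood2surj : ∀ δ : ℤ, δ ≤ 1 → ∀ y ∈ gr2 (δ - 2), ∃ x ∈ gr2 δ, ⁅f2, x⁆ = y)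
    (hstar1 : (⨆ d : ℤ, ⨆ _ : (2 : ℤ) ≤ d, gr1 d) ≤ ⨆ d : ℤ, ⨆ _ : (1 : ℤ) ≤ d, gr2 d)
    (hstar2 : (⨆ d : ℤ, ⨆ _ : (1 : ℤ) ≤ d, gr2 d) ≤ ⨆ d : ℤ, ⨆ _ : (0 : ℤ) ≤ d, gr1 d)
    (hstar3 : gr1 1 ≤ (gr1 1 ⊓ gr2 0) ⊔ (gr1 1 ⊓ gr2 1) ⊔ (gr1 1 ⊓ gr2 2))
    (hstar4 : gr2 1 ≤ (gr2 1 ⊓ gr1 0) ⊔ (gr2 1 ⊓ gr1 1) ⊔ (gr2 1 ⊓ gr1 2))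
    (hstar5 : f2 - f1 ∈ gr1 0 ⊓ gr2 (-2))
    (aa : Submodule ℂ g)
    (ha1 : aa ≤ (gr2 1 ⊓ gr1 0) ⊓ LinearMap.ker (LieAlgebra.ad ℂ g f1 : g →ₗ[ℂ] g))
    (ha2 : ∀ u ∈ aa ⊔ (gr2 1 ⊓ gr1 2), ∀ v ∈ aa ⊔ (gr2 1 ⊓ gr1 2), Φ f2 ⁅u, v⁆ = 0)
    (ha3 : {v : g | v ∈ gr2 1 ∧ ∀ u ∈ aa ⊔ (gr2 1 ⊓ gr1 2), Φ f2 ⁅v, u⁆ = 0}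
        = ↑(aa ⊔ (gr2 1 ⊓ gr1 1) ⊔ (gr2 1 ⊓ gr1 2)))
    (n0 n1 n2 : Submodule ℂ g)
    (hn0 : n0 = aa ⊔ (gr1 0 ⊓ (⨆ d : ℤ, ⨆ _ : (2 : ℤ) ≤ d, gr2 d)))
    (hn1 : n1 = ((gr1 1 ⊓ gr2 1) ⊔ (gr1 1 ⊓ gr2 2)) ⊔ (⨆ d : ℤ, ⨆ _ : (2 : ℤ) ≤ d, gr1 d))
    (hn2 : n2 = (aa ⊔ (gr1 1 ⊓ gr2 1) ⊔ (gr1 2 ⊓ gr2 1)) ⊔ (⨆ d : ℤ, ⨆ _ : (2 : ℤ) ≤ d, gr2 d))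
    (nt1 nt2 : Submodule ℂ g)
    (hnt1 : nt1 = ⨆ d : ℤ, ⨆ _ : (1 : ℤ) ≤ d, gr1 d)
    (hnt2 : nt2 = nt1 ⊔ n0)
    (hsub : n2 ≤ nt2)
    (K : ℕ) (hK : ∀ v ∈ nt2, (LieAlgebra.ad ℂ g v : Module.End ℂ g) ^ (K + 1) = 0) :
    let F : g → Module.Dual ℂ g := fun v =>
      ∑ k ∈ Finset.range (K + 1), ((-1 : ℂ) ^ k * ((k.factorial : ℂ))⁻¹) •
        ((Φ f2) ∘ₗ ((LieAlgebra.ad ℂ g v : Module.End ℂ g) ^ k : g →ₗ[ℂ] g))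
    let pi2 : Module.Dual ℂ g →ₗ[ℂ] Module.Dual ℂ n2 := LinearMap.dualMap n2.subtype
    let pit2 : Module.Dual ℂ g →ₗ[ℂ] Module.Dual ℂ nt2 := LinearMap.dualMap nt2.subtype
    let O2neg : Set (Module.Dual ℂ n2) := {ξ | ∃ v ∈ n2, ξ = pi2 (-(F v))}
    let Ot2neg : Set (Module.Dual ℂ nt2) := {ξ | ∃ v ∈ nt2, ξ = pit2 (-(F v))}
    let adstar : Set g → Submodule ℂ (Module.Dual ℂ g) := fun s =>
      Submodule.span ℂ {η : Module.Dual ℂ g |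
        ∃ w ∈ s, η = -((Φ f2) ∘ₗ (LieAlgebra.ad ℂ g w : g →ₗ[ℂ] g))}
    -- the fiber inclusion
    ({ξ : Module.Dual ℂ g | pi2 ξ ∈ O2neg} ⊆ {ξ : Module.Dual ℂ g | pit2 ξ ∈ Ot2neg}) ∧
    -- `n₂^⊥ = ñ₂^⊥ ⊕ ad*(g_{1,2})χ₂`
    (Submodule.dualAnnihilator n2
      = Submodule.dualAnnihilator nt2 ⊔ adstar ↑(gr1 1 ⊓ gr2 2)) ∧
    (Submodule.dualAnnihilator nt2 ⊓ adstar ↑(gr1 1 ⊓ gr2 2) = ⊥) ∧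
    -- `π₂⁻¹(O₂⁻) = -χ₂ + ad*(g_{1,1})χ₂ ⊕ n₂^⊥`
    ({ξ : Module.Dual ℂ g | pi2 ξ ∈ O2neg}
      = {ξ : Module.Dual ℂ g | ∃ v ∈ gr1 1 ⊓ gr2 1,
          ∃ η ∈ Submodule.dualAnnihilator n2,
          ξ = -(Φ f2) - (Φ f2) ∘ₗ (LieAlgebra.ad ℂ g v : g →ₗ[ℂ] g) + η}) ∧
    -- explicit description of `π̃₂⁻¹(Õ₂⁻)`
    ({ξ : Module.Dual ℂ g | pit2 ξ ∈ Ot2neg}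
      = {ξ : Module.Dual ℂ g | ∃ v ∈ gr1 1 ⊓ gr2 0, ∃ w ∈ gr1 1 ⊓ gr2 1,
          ∃ η ∈ Submodule.dualAnnihilator n2,
          ξ = -(Φ f2) - (Φ f2) ∘ₗ (LieAlgebra.ad ℂ g v : g →ₗ[ℂ] g)
              - (Φ f2) ∘ₗ (LieAlgebra.ad ℂ g w : g →ₗ[ℂ] g)
              - (2⁻¹ : ℂ) •
                ((Φ f2) ∘ₗ (((LieAlgebra.ad ℂ g (v + w) : Module.End ℂ g) ^ 2) : g →ₗ[ℂ] g))
              + η}) := by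
  have star_support : ∀ i j : ℤ, ∀ x ∈ gr1 i, x ∈ gr2 j → x ≠ 0 → StarSupport i j := by
    intro i j x hx1 hx2 hx0
    refine ⟨fun hi => ?_, fun hj => ?_, fun hi => ?_, fun hj => ?_⟩
    · by_contra hj
      exact hx0 (eq_zero_of_mem_grading_of_mem_iSup hdec2.submodule_iSupIndep hx2 {d | 1 ≤ d}
        (hstar1 ((le_iSup₂_of_le (f := fun d (_ : (2 : ℤ) ≤ d) => gr1 d) i hi le_rfl) hx1)) hj)
    · by_contra hi
      exact hx0 (eq_zero_of_mem_grading_of_mem_iSup hdec1.submodule_iSupIndep hx1 {d | 0 ≤ d}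
        (hstar2 ((le_iSup₂_of_le (f := fun d (_ : (1 : ℤ) ≤ d) => gr2 d) j hj le_rfl) hx2)) hi)
    · subst hi
      by_contra hj
      refine hx0 (eq_zero_of_mem_grading_of_mem_iSup hdec2.submodule_iSupIndep hx2
        {d | 0 ≤ d ∧ d ≤ 2} ?_ hj)
      have hle : ((gr1 1 ⊓ gr2 0) ⊔ (gr1 1 ⊓ gr2 1) ⊔ (gr1 1 ⊓ gr2 2)) ≤
          ⨆ d ∈ {d : ℤ | 0 ≤ d ∧ d ≤ 2}, gr2 d :=
        sup_le (sup_le (inf_le_right.trans (le_biSup gr2 (by simp)))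
          (inf_le_right.trans (le_biSup gr2 (by simp))))
          (inf_le_right.trans (le_biSup gr2 (by simp)))
      exact hle (hstar3 hx1)
    · subst hj
      by_contra hi
      refine hx0 (eq_zero_of_mem_grading_of_mem_iSup hdec1.submodule_iSupIndep hx1
        {d | 0 ≤ d ∧ d ≤ 2} ?_ hi)
      have hle : ((gr2 1 ⊓ gr1 0) ⊔ (gr2 1 ⊓ gr1 1) ⊔ (gr2 1 ⊓ gr1 2)) ≤
          ⨆ d ∈ {d : ℤ | 0 ≤ d ∧ d ≤ 2}, gr1 d :=
        sup_le (sup_le (inf_le_right.trans (le_biSup gr1 (by simp)))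
          (inf_le_right.trans (le_biSup gr1 (by simp))))
          (inf_le_right.trans (le_biSup gr1 (by simp)))
      exact hle (hstar4 hx2)
  have orth1 : ∀ {i j : ℤ}, i + j ≠ 0 → ∀ {x y : g}, x ∈ gr1 i → y ∈ gr1 j → Φ x y = 0 :=
    fun h _ _ hx hy => invariant_form_apply_eq_zero_of_grading Φ hinv gr1 hdec1 hbr1 h hx hy
  have orth2 : ∀ {i j : ℤ}, i + j ≠ 0 → ∀ {x y : g}, x ∈ gr2 i → y ∈ gr2 j → Φ x y = 0 :=
    fun h _ _ hx hy => invariant_form_apply_eq_zero_of_grading Φ hinv gr2 hdec2 hbr2 h hx hy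
  have hf12 : f1 ∈ gr2 (-2) := by simpa using sub_mem hf2 hstar5.2
  have H : StarGrading gr1 gr2 (Φ f2) aa :=
    { lie_mem₁ := hbr1
      lie_mem₂ := hbr2
      starSupport := star_support
      χ_eq_zero := by
        intro i j x hx1 hx2 hij
        by_cases hj : j = 2
        · have h1 : Φ f1 x = 0 := orth1 (by omega) hf1 hx1
          have h0 : Φ (f2 - f1) x = 0 := orth1 (by omega) hstar5.1 hx1
          simpa [h1] using h0
        · exact orth2 (by omega) hf2 hx2
      aa_le := fun x hx => ⟨(ha1 hx).1.2, (ha1 hx).1.1⟩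
      χ_lie_aa_aa := fun x hx y hy =>
        ha2 x (Submodule.mem_sup_left hx) y (Submodule.mem_sup_left hy)
      χ_lie_aa := fun x hx y hy =>
        ha2 x (Submodule.mem_sup_left hx) y (Submodule.mem_sup_right ⟨hy.2, hy.1⟩) }
  have hbitop : ⨆ p : ℤ × ℤ, gr1 p.1 ⊓ gr2 p.2 = ⊤ := hbidec.submodule_iSup_eq_top
  have hgr1 : ∀ i, gr1 i ≤ bigradedSum gr1 gr2 fun k _ => k = i :=
    le_iSup_of_refines_grading gr1 hdec1.submodule_iSupIndep _ Prod.fst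
      (fun _ => inf_le_left) hbitop
  have hgr2 : ∀ j, gr2 j ≤ bigradedSum gr1 gr2 fun _ l => l = j :=
    le_iSup_of_refines_grading gr2 hdec2.submodule_iSupIndep _ Prod.snd
      (fun _ => inf_le_right) hbitop
  have hpiece : ∀ m n : ℤ, gr1 m ⊓ gr2 n = bigradedSum gr1 gr2 fun i j => i = m ∧ j = n :=
    fun m n => le_antisymm (StarGrading.inf_le_bigradedSum ⟨rfl, rfl⟩) (H.bigradedSum_eq_le m n)
  have hge2 : (⨆ d : ℤ, ⨆ _ : (2 : ℤ) ≤ d, gr2 d) = bigradedSum gr1 gr2 fun _ j => 2 ≤ j :=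
    le_antisymm
      (iSup₂_le fun d hd => (hgr2 d).trans (H.bigradedSum_mono (by intros; omega)))
      (H.bigradedSum_le fun i j _ hj => inf_le_right.trans (le_iSup₂_of_le j hj le_rfl))
  rw [hpiece 1 1, hpiece 2 1, hge2] at hn2
  have hnt2pos : nt2 ≤ bigradedSum gr1 gr2 fun i j => 0 ≤ i ∧ 0 ≤ j ∧ (1 ≤ i ∨ 1 ≤ j) := by
    rw [hnt2, hnt1, hn0, hge2]
    refine sup_le (iSup₂_le fun d hd => (hgr1 d).trans ?_) (sup_le ?_ (inf_le_right.trans ?_))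
    · exact H.bigradedSum_mono (by simp only [StarSupport]; intros; omega)
    · exact H.aa_le_bigradedSum (by omega)
    · exact H.bigradedSum_mono (by simp only [StarSupport]; intros; omega)
  have hn2pos : n2 ≤ bigradedSum gr1 gr2 fun _ j => 1 ≤ j := by
    rw [hn2]
    refine sup_le (sup_le (sup_le (H.aa_le_bigradedSum (by omega)) ?_) ?_) ?_ <;>
    · exact H.bigradedSum_mono (by intros; omega)
  have hgr1nt2 : gr1 1 ≤ nt2 := by
    rw [hnt2, hnt1]
    exact le_sup_of_le_left (le_iSup₂_of_le (f := fun d (_ : (1 : ℤ) ≤ d) => gr1 d) 1 le_rfl le_rfl)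
  have hnt2le : nt2 ≤ (gr1 1 ⊓ gr2 0) ⊔ n2 := by
    rw [hnt2, hnt1, hn0, hge2, hn2, hpiece 1 0]
    refine sup_le (iSup₂_le fun d hd => (hgr1 d).trans (H.bigradedSum_le fun i j hs hi => ?_))
      (sup_le ?_ (inf_le_right.trans ?_))
    · by_cases hj : 2 ≤ j
      · exact (StarGrading.inf_le_bigradedSum (P := fun _ l => 2 ≤ l) hj).trans
          (le_sup_of_le_right le_sup_right)
      have hcases : (i = 1 ∧ j = 0) ∨ (i = 1 ∧ j = 1) ∨ (i = 2 ∧ j = 1) := by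
        simp only [StarSupport] at hs; omega
      rcases hcases with h | h | h
      · exact (StarGrading.inf_le_bigradedSum (P := fun k l => k = 1 ∧ l = 0) h).trans le_sup_left
      · exact (StarGrading.inf_le_bigradedSum (P := fun k l => k = 1 ∧ l = 1) h).trans
          (le_sup_of_le_right (le_sup_of_le_left (le_sup_of_le_left le_sup_right)))
      · exact (StarGrading.inf_le_bigradedSum (P := fun k l => k = 2 ∧ l = 1) h).trans
          (le_sup_of_le_right (le_sup_of_le_left le_sup_right))
    · exact le_sup_of_le_right (le_sup_of_le_left (le_sup_of_le_left le_sup_left))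
    · exact le_sup_of_le_right le_sup_right
  have hsplit : ∀ s ∈ gr1 1 ⊓ gr2 0, ∀ q ∈ n2, ∃ a u b r,
      StarGrading.Split gr1 gr2 aa s a u b r ∧ q = a + u + b + r := by
    intro s hs q hq
    rw [hn2] at hq
    obtain ⟨y, hy, r, hr, rfl⟩ := Submodule.mem_sup.mp hq
    obtain ⟨z, hz, b, hb, rfl⟩ := Submodule.mem_sup.mp hy
    obtain ⟨a, ha, u, hu, rfl⟩ := Submodule.mem_sup.mp hz
    rw [hpiece] at hs
    exact ⟨a, u, b, r, ⟨hs, ha, H.aa_le_bigradedSum ⟨rfl, rfl⟩ ha, hu, hb, hr⟩, rfl⟩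
  have hf1c : ∀ c ∈ gr1 1, ∀ x ∈ gr1 1, Φ f2 ⁅c, x⁆ = Φ ⁅f1, c⁆ x := by
    intro c hc x hx
    have h0 : Φ ⁅f2 - f1, c⁆ x = 0 := orth1 (by norm_num) (hbr1 _ _ _ hstar5.1 _ hc) hx
    rw [← hinv, ← sub_eq_zero, ← LinearMap.sub_apply, ← map_sub, ← sub_lie]
    exact h0
  have hrep : ∀ ξ : Module.Dual ℂ g, ∃ c ∈ gr1 1 ⊓ gr2 2, ∀ x ∈ gr1 1 ⊓ gr2 0,
      ξ x = Φ f2 ⁅c, x⁆ := by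
    intro ξ
    have hinj : Function.Injective Φ := by
      rw [injective_iff_map_eq_zero]
      exact fun x hx => hnondeg x fun y => by rw [hx]; rfl
    obtain ⟨y, rfl⟩ := (LinearMap.injective_iff_surjective_of_finrank_eq_finrank
      (Subspace.dual_finrank_eq (K := ℂ) (V := g)).symm).mp hinj ξ
    have hy : ∃ y' ∈ gr1 (1 - 2), ∀ x ∈ gr1 1, Φ y x = Φ y' x := by
      have hytop : y ∈ ⨆ i, gr1 i := by rw [hdec1.submodule_iSup_eq_top]; trivial
      induction hytop using Submodule.iSup_induction' with
      | mem i y hy =>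
        by_cases hi : i = 1 - 2
        · exact ⟨y, hi ▸ hy, fun _ _ => rfl⟩
        · exact ⟨0, zero_mem _, fun x hx => by
            rw [orth1 (by omega) hy hx, map_zero, LinearMap.zero_apply]⟩
      | zero => exact ⟨0, zero_mem _, fun _ _ => rfl⟩
      | add y z _ _ h1 h2 =>
        obtain ⟨y', hy', h1⟩ := h1
        obtain ⟨z', hz', h2⟩ := h2
        exact ⟨y' + z', add_mem hy' hz', fun x hx => by
          simp only [map_add, LinearMap.add_apply, h1 x hx, h2 x hx]⟩
    obtain ⟨y', hy', hyy'⟩ := hy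
    obtain ⟨c, hc, rfl⟩ := hgood1surj 1 le_rfl y' hy'
    obtain ⟨c', hc', c2, hc2, rfl⟩ := Submodule.mem_sup.mp (hstar3 hc)
    obtain ⟨c0, hc0, c1, hc1, rfl⟩ := Submodule.mem_sup.mp hc'
    refine ⟨c2, hc2, fun x hx => ?_⟩
    have h0 : Φ ⁅f1, c0⁆ x = 0 := orth2 (by norm_num) (hbr2 _ _ _ hf12 _ hc0.2) hx.2
    have h1 : Φ ⁅f1, c1⁆ x = 0 := orth2 (by norm_num) (hbr2 _ _ _ hf12 _ hc1.2) hx.2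
    rw [hyy' x hx.1, hf1c c2 hc2.1 x hx.1, lie_add, lie_add]
    simp [h0, h1]
  have hχn2 : ∀ c ∈ gr1 1 ⊓ gr2 2, ∀ x ∈ n2, Φ f2 ⁅c, x⁆ = 0 := by
    intro c hc x hx
    rw [hpiece] at hc
    exact H.χ_lie_eq_zero hc (hn2pos hx) (by intros; omega)
  have hcorrect : ∀ η ∈ n2.dualAnnihilator, ∃ c ∈ gr1 1 ⊓ gr2 2, ∀ x ∈ nt2,
      η x = -Φ f2 ⁅c, x⁆ := by
    intro η hη
    obtain ⟨c, hc, h⟩ := hrep (-η)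
    refine ⟨c, hc, fun x hx => ?_⟩
    obtain ⟨y, hy, z, hz, rfl⟩ := Submodule.mem_sup.mp (hnt2le hx)
    rw [lie_add, map_add, map_add, ← h y hy, hχn2 c hc z hz,
      (Submodule.mem_dualAnnihilator η).mp hη z hz]
    simp
  have hquad : ∀ w ∈ gr1 1 ⊓ gr2 1, StarGrading.quadraticForm (Φ f2) 0 w -
      (-(Φ f2) - (Φ f2) ∘ₗ (LieAlgebra.ad ℂ g w : g →ₗ[ℂ] g)) ∈ n2.dualAnnihilator := by
    intro w hw
    rw [hpiece] at hw
    rw [Submodule.mem_dualAnnihilator]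
    intro x hx
    have hwx := H.lie_mem (R := fun _ j => 2 ≤ j) hw (hn2pos hx) (by intros; omega)
    rw [LinearMap.sub_apply, StarGrading.quadraticForm_apply]
    simp [H.χ_lie_eq_zero hw hwx (by intros; omega)]
  intro F pi2 pit2 O2neg Ot2neg adstar
  have part4 : {ξ : Module.Dual ℂ g | pi2 ξ ∈ O2neg}
      = {ξ : Module.Dual ℂ g | ∃ v ∈ gr1 1 ⊓ gr2 1,
          ∃ η ∈ Submodule.dualAnnihilator n2,
          ξ = -(Φ f2) - (Φ f2) ∘ₗ (LieAlgebra.ad ℂ g v : g →ₗ[ℂ] g) + η} := by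
    ext ξ
    constructor
    · rintro ⟨v, hv, hξ⟩
      have hξ' := (dualMap_subtype_eq_iff n2 ξ _).mp hξ
      obtain ⟨a, u, b, r, V, rfl⟩ := hsplit 0 (zero_mem _) v hv
      have h := H.neg_coadExp_sub_quadraticForm_mem V (n := K + 1)
        (by rw [zero_add]; exact hK _ (hsub hv))
      rw [← hn2] at h
      simp only [zero_add, neg_zero, zero_lie, smul_zero, sub_zero] at h
      have hu : -u ∈ gr1 1 ⊓ gr2 1 := by rw [hpiece]; exact neg_mem V.u
      refine ⟨-u, hu, _, ?_, (add_sub_cancel _ ξ).symm⟩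
      have := add_mem (add_mem hξ' h) (hquad _ hu)
      convert this using 1
      change _ = ξ - -coadExp (Φ f2) (K + 1) (a + u + b + r) + _ + _
      abel
    · rintro ⟨w, hw, η, hη, rfl⟩
      have hwn2 : -w ∈ n2 := by
        rw [hn2, ← hpiece 1 1]
        exact neg_mem (Submodule.mem_sup_left (Submodule.mem_sup_left (Submodule.mem_sup_right hw)))
      refine ⟨-w, hwn2, (dualMap_subtype_eq_iff n2 _ _).mpr ?_⟩
      have V : StarGrading.Split gr1 gr2 aa 0 0 (-w) 0 0 :=
        ⟨zero_mem _, zero_mem _, zero_mem _, by rw [← hpiece]; exact neg_mem hw, zero_mem _,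
          zero_mem _⟩
      have h := H.neg_coadExp_sub_quadraticForm_mem V (n := K + 1)
        (by simp only [zero_add, add_zero]; exact hK _ (hsub hwn2))
      rw [← hn2] at h
      simp only [zero_add, add_zero, neg_zero, zero_lie, smul_zero, sub_zero, neg_neg] at h
      have := sub_mem (sub_mem hη h) (hquad _ hw)
      convert this using 1
      change _ - -coadExp (Φ f2) (K + 1) (-w) = _
      abel
  have part5 : {ξ : Module.Dual ℂ g | pit2 ξ ∈ Ot2neg}
      = {ξ : Module.Dual ℂ g | ∃ v ∈ gr1 1 ⊓ gr2 0, ∃ w ∈ gr1 1 ⊓ gr2 1,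
          ∃ η ∈ Submodule.dualAnnihilator n2,
          ξ = StarGrading.quadraticForm (Φ f2) v w + η} := by
    ext ξ
    constructor
    · rintro ⟨v, hv, hξ⟩
      have hξ' := Submodule.dualAnnihilator_anti hsub ((dualMap_subtype_eq_iff nt2 ξ _).mp hξ)
      obtain ⟨s, hs, q, hq, rfl⟩ := Submodule.mem_sup.mp (hnt2le hv)
      obtain ⟨a, u, b, r, V, rfl⟩ := hsplit s hs q hq
      have h := H.neg_coadExp_sub_quadraticForm_mem V (n := K + 1) (hK _ hv)
      rw [← hn2] at h
      have hm : -(u - (2⁻¹ : ℂ) • ⁅s, a⁆) ∈ gr1 1 ⊓ gr2 1 := by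
        rw [hpiece]
        exact neg_mem (sub_mem V.u (Submodule.smul_mem _ _ (H.lie_mem V.s V.a (by intros; omega))))
      refine ⟨-s, neg_mem hs, _, hm, _, ?_, (add_sub_cancel _ ξ).symm⟩
      convert add_mem hξ' h using 1
      change _ = ξ - -coadExp (Φ f2) (K + 1) (s + (a + u + b + r)) + _
      abel
    · rintro ⟨v, hv, w, hw, η, hη, rfl⟩
      obtain ⟨c, hc, h⟩ := hcorrect η hη
      have hmem : -(v + w + c) ∈ nt2 :=
        neg_mem (hgr1nt2 (add_mem (add_mem hv.1 hw.1) hc.1))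
      refine ⟨_, hmem, (dualMap_subtype_eq_iff nt2 _ _).mpr ?_⟩
      rw [Submodule.mem_dualAnnihilator]
      intro x hx
      rw [hpiece] at hv hw hc
      have := H.neg_coadExp_neg_apply hv hw hc (hK _ hmem) (hnt2pos hx)
      change StarGrading.quadraticForm (Φ f2) v w x + η x -
        -coadExp (Φ f2) (K + 1) (-(v + w + c)) x = 0
      rw [this, h x hx]
      ring
  refine ⟨?_, ?_, ?_, part4, part5⟩
  · rw [part4, part5]
    rintro _ ⟨w, hw, η, hη, rfl⟩
    refine ⟨0, zero_mem _, w, hw, _, sub_mem hη (hquad w hw), ?_⟩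
    abel
  · refine le_antisymm (fun η hη => ?_) (sup_le (Submodule.dualAnnihilator_anti hsub) ?_)
    · obtain ⟨c, hc, h⟩ := hcorrect η hη
      have hc' : -((Φ f2) ∘ₗ (LieAlgebra.ad ℂ g c : g →ₗ[ℂ] g)) ∈ adstar ↑(gr1 1 ⊓ gr2 2) :=
        Submodule.subset_span ⟨c, hc, rfl⟩
      refine Submodule.mem_sup.mpr ⟨_, ?_, _, hc', sub_add_cancel η _⟩
      rw [Submodule.mem_dualAnnihilator]
      intro x hx
      simp [h x hx]
    · refine Submodule.span_le.mpr ?_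
      rintro _ ⟨c, hc, rfl⟩
      rw [SetLike.mem_coe, Submodule.mem_dualAnnihilator]
      intro x hx
      simp [hχn2 c hc x hx]
  · rw [Submodule.eq_bot_iff]
    rintro ξ ⟨hξ, hξ'⟩
    have hc : ∃ c ∈ gr1 1 ⊓ gr2 2, ξ = -((Φ f2) ∘ₗ (LieAlgebra.ad ℂ g c : g →ₗ[ℂ] g)) := by
      clear hξ
      change ξ ∈ Submodule.span ℂ _ at hξ'
      induction hξ' using Submodule.span_induction with
      | mem x h => exact h
      | zero => exact ⟨0, zero_mem _, by simp⟩
      | add x y _ _ h1 h2 =>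
        obtain ⟨c, hc, rfl⟩ := h1
        obtain ⟨d, hd, rfl⟩ := h2
        exact ⟨c + d, add_mem hc hd, by ext x; simp; ring⟩
      | smul t x _ h =>
        obtain ⟨c, hc, rfl⟩ := h
        exact ⟨t • c, Submodule.smul_mem _ _ hc, by ext x; simp⟩
    obtain ⟨c, hc, rfl⟩ := hc
    have hz : ⁅f1, c⁆ = 0 := by
      refine hnondeg _ fun y => ?_
      have hy : y ∈ ⨆ p : ℤ × ℤ, gr1 p.1 ⊓ gr2 p.2 := by rw [hbitop]; trivial
      refine (iSup_le fun p z hz => ?_ : _ ≤ LinearMap.ker (Φ ⁅f1, c⁆)) hy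
      rw [LinearMap.mem_ker]
      by_cases h1 : p.1 = 1
      · by_cases h2 : p.2 = 0
        · rw [h1, h2] at hz
          rw [← hf1c c hc.1 z hz.1]
          simpa using (Submodule.mem_dualAnnihilator _).mp hξ z (hgr1nt2 hz.1)
        · exact orth2 (by omega) (hbr2 _ _ _ hf12 _ hc.2) hz.2
      · exact orth1 (by omega) (hbr1 _ _ _ hf1 _ hc.1) hz.1
    rw [hgood1inj 1 le_rfl c hc.1 hz]
    simp
end
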